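/- With μ_d, ν_d defined as the positive/negative parts of the degree-k Legendre harmonic density on S^{d-1}, and σ a bounded activation, the ratio of the F_1 IPM to the F_2 (kernel MMD) IPM equals √N_{k,d} = √((2k+d−2)(k+d−3)!/(k!(d−2)!)), provided the common Funk–Hecke coefficient ∫_{−1}^{1} P_{k,d}(t)σ(t)(1−t^2)^{(d−3)/2} dt is nonzero. -/

import Mathlib

namespace S11
open MeasureTheory
open scoped RealInnerProductSpace

variable {d : ℕ}

theorem hasDerivAt_eval (p : MvPolynomial (Fin d) ℝ) (c : ℝ → Fin d → ℝ) (c' : Fin d → ℝ) (s : ℝ)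
    (hc : ∀ i, HasDerivAt (fun s => c s i) (c' i) s) :
    HasDerivAt (fun s => MvPolynomial.eval (c s) p)
      (∑ i, MvPolynomial.eval (c s) (MvPolynomial.pderiv i p) * c' i) s := by
  induction p using MvPolynomial.induction_on with
  | C a => simpa using hasDerivAt_const s a
  | add p q hp hq =>
    simp only [map_add]
    refine (hp.fun_add hq).congr_deriv ?_
    simp [add_mul, Finset.sum_add_distrib]
  | mul_X p j hp =>
    simp only [map_mul, MvPolynomial.eval_X]
    refine (hp.fun_mul (hc j)).congr_deriv ?_
    simp only [Derivation.leibniz, MvPolynomial.pderiv_X, smul_eq_mul, map_add, map_mul, MvPolynomial.eval_X]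
    simp only [add_mul, Finset.sum_add_distrib, Finset.sum_mul]
    rw [add_comm]
    congr 1
    · symm
      rw [Finset.sum_eq_single j]
      · simp
      · intro b _ hb
        rw [Pi.single_eq_of_ne (Ne.symm hb)]; simp
      · simp
    · refine Finset.sum_congr rfl fun i _ => by ring

/-- coordinates of the rotation -/
noncomputable def rotF (i j : Fin d) (s : ℝ) (x : Fin d → ℝ) : Fin d → ℝ := fun l =>
  if l = i then Real.cos s * x i - Real.sin s * x j
  else if l = j then Real.sin s * x i + Real.cos s * x j else x l

theorem rotF_sq (i j : Fin d) (hij : i ≠ j) (s : ℝ) (x : Fin d → ℝ) :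
    ∑ l, rotF i j s x l ^ 2 = ∑ l, x l ^ 2 := by
  have key : ∀ f : Fin d → ℝ, ∑ l, f l = f i + (f j + ∑ l ∈ (Finset.univ.erase i).erase j, f l) := by
    intro f
    rw [Finset.add_sum_erase _ f (by simp [hij.symm]), Finset.add_sum_erase _ f (by simp)]
  rw [key, key (fun l => x l ^ 2)]
  have : ∑ l ∈ (Finset.univ.erase i).erase j, rotF i j s x l ^ 2
      = ∑ l ∈ (Finset.univ.erase i).erase j, x l ^ 2 := by
    refine Finset.sum_congr rfl fun l hl => ?_
    simp only [Finset.mem_erase] at hl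
    simp [rotF, hl.1, hl.2.1]
  rw [this]
  simp only [rotF, if_true, if_neg hij.symm]
  linear_combination (x i ^ 2 + x j ^ 2) * Real.sin_sq_add_cos_sq s

noncomputable def rotL (i j : Fin d) (hij : i ≠ j) (s : ℝ) :
    EuclideanSpace ℝ (Fin d) →ₗᵢ[ℝ] EuclideanSpace ℝ (Fin d) where
  toFun x := WithLp.toLp 2 (rotF i j s x)
  map_add' x y := by
    ext l; simp only [rotF, PiLp.add_apply]; split_ifs <;> ring
  map_smul' a x := by
    ext l; simp only [rotF, PiLp.smul_apply, smul_eq_mul, RingHom.id_apply]; split_ifs <;> ring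
  norm_map' x := by
    simp only [LinearMap.coe_mk, AddHom.coe_mk, EuclideanSpace.norm_eq, Real.norm_eq_abs, sq_abs]
    rw [rotF_sq i j hij]

noncomputable def rotE (i j : Fin d) (hij : i ≠ j) (s : ℝ) :
    EuclideanSpace ℝ (Fin d) ≃ₗᵢ[ℝ] EuclideanSpace ℝ (Fin d) :=
  (rotL i j hij s).toLinearIsometryEquiv rfl

/-- evaluation on the sphere -/
noncomputable def ev (p : MvPolynomial (Fin d) ℝ)
    (x : Metric.sphere (0 : EuclideanSpace ℝ (Fin d)) 1) : ℝ :=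
  MvPolynomial.eval (fun i => (x : EuclideanSpace ℝ (Fin d)) i) p

theorem cont_eval (p : MvPolynomial (Fin d) ℝ) :
    Continuous (fun x : EuclideanSpace ℝ (Fin d) => MvPolynomial.eval (fun i => x i) p) :=
  (MvPolynomial.continuous_eval p).comp (by fun_prop)

theorem cont_ev (p : MvPolynomial (Fin d) ℝ) : Continuous (ev p) :=
  (cont_eval p).comp continuous_subtype_val

theorem ev_bdd (p : MvPolynomial (Fin d) ℝ) : ∃ C, ∀ x, |ev p x| ≤ C := by
  obtain ⟨C, hC⟩ := (isCompact_univ.image (cont_ev p)).isBounded.exists_norm_le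
  exact ⟨C, fun x => hC _ ⟨x, trivial, rfl⟩⟩

theorem int_cont (τ : Measure (Metric.sphere (0 : EuclideanSpace ℝ (Fin d)) 1))
    [IsProbabilityMeasure τ] (f : Metric.sphere (0 : EuclideanSpace ℝ (Fin d)) 1 → ℝ)
    (hf : Continuous f) : Integrable f τ := by
  obtain ⟨C, hC⟩ := (isCompact_univ.image hf).isBounded.exists_norm_le
  exact Integrable.of_bound hf.aestronglyMeasurable C (ae_of_all _ fun x => hC _ ⟨x, trivial, rfl⟩)

theorem int_ev (τ : Measure (Metric.sphere (0 : EuclideanSpace ℝ (Fin d)) 1))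
    [IsProbabilityMeasure τ] (p : MvPolynomial (Fin d) ℝ) : Integrable (ev p) τ :=
  int_cont τ _ (cont_ev p)

def Inv (τ : Measure (Metric.sphere (0 : EuclideanSpace ℝ (Fin d)) 1)) : Prop :=
  ∀ O : EuclideanSpace ℝ (Fin d) ≃ₗᵢ[ℝ] EuclideanSpace ℝ (Fin d),
      ∀ f : EuclideanSpace ℝ (Fin d) → ℝ, Continuous f →
        ∫ x, f (O (x : EuclideanSpace ℝ (Fin d))) ∂τ
          = ∫ x, f (x : EuclideanSpace ℝ (Fin d)) ∂τ

theorem rot_zero (τ : Measure (Metric.sphere (0 : EuclideanSpace ℝ (Fin d)) 1))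
    [IsProbabilityMeasure τ] (hinv : Inv τ) (i j : Fin d) (p : MvPolynomial (Fin d) ℝ) :
    ∫ x, ev (MvPolynomial.X j * MvPolynomial.pderiv i p
      - MvPolynomial.X i * MvPolynomial.pderiv j p) x ∂τ = 0 := by
  by_cases hij : i = j
  · subst hij; simp [ev]
  set q := MvPolynomial.X j * MvPolynomial.pderiv i p - MvPolynomial.X i * MvPolynomial.pderiv j p
    with hq
  have hmem : ∀ (s : ℝ) (x : Metric.sphere (0 : EuclideanSpace ℝ (Fin d)) 1),
      rotE i j hij s x ∈ Metric.sphere (0 : EuclideanSpace ℝ (Fin d)) 1 := by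
    intro s x
    have := x.2
    simp only [mem_sphere_zero_iff_norm] at this ⊢
    rw [LinearIsometryEquiv.norm_map, this]
  obtain ⟨C, hC⟩ := ev_bdd q
  have hder : ∀ (x : Metric.sphere (0 : EuclideanSpace ℝ (Fin d)) 1) (s : ℝ),
      HasDerivAt (fun s => ev p ⟨_, hmem s x⟩) (- ev q ⟨_, hmem s x⟩) s := by
    intro x s
    have h := hasDerivAt_eval p (fun s => rotF i j s (x : EuclideanSpace ℝ (Fin d)))
      (fun l => if l = i then - rotF i j s (x : EuclideanSpace ℝ (Fin d)) j
        else if l = j then rotF i j s (x : EuclideanSpace ℝ (Fin d)) i else 0) s (by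
          intro l
          by_cases h1 : l = i
          · subst h1
            simp only [rotF, if_true, if_neg (Ne.symm hij)]
            refine (((Real.hasDerivAt_cos s).mul_const _).fun_sub ((Real.hasDerivAt_sin s).mul_const _)).congr_deriv ?_
            ring
          · by_cases h2 : l = j
            · subst h2
              simp only [rotF, if_true, if_neg h1]
              refine (((Real.hasDerivAt_sin s).mul_const _).fun_add ((Real.hasDerivAt_cos s).mul_const _)).congr_deriv ?_
              ring
            · simp only [rotF, if_neg h1, if_neg h2]
              exact hasDerivAt_const _ _)
    refine HasDerivAt.congr_deriv h ?_
    have e1 : ∀ l, MvPolynomial.eval (rotF i j s (x : EuclideanSpace ℝ (Fin d))) (MvPolynomial.pderiv l p) *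
        (if l = i then - rotF i j s (x : EuclideanSpace ℝ (Fin d)) j
        else if l = j then rotF i j s (x : EuclideanSpace ℝ (Fin d)) i else 0)
        = (if l = i then - (rotF i j s (x : EuclideanSpace ℝ (Fin d)) j * MvPolynomial.eval (rotF i j s (x : EuclideanSpace ℝ (Fin d))) (MvPolynomial.pderiv i p)) else 0)
         + (if l = j then (rotF i j s (x : EuclideanSpace ℝ (Fin d)) i * MvPolynomial.eval (rotF i j s (x : EuclideanSpace ℝ (Fin d))) (MvPolynomial.pderiv j p)) else 0) := by
      intro l
      by_cases h1 : l = i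
      · subst h1; simp [hij]; ring
      · by_cases h2 : l = j
        · subst h2; simp [h1]; ring
        · simp [h1, h2]
    simp_rw [e1, Finset.sum_add_distrib]
    simp only [Finset.sum_ite_eq', Finset.mem_univ, if_true]
    have : ev q ⟨_, hmem s x⟩ = MvPolynomial.eval (rotF i j s (x : EuclideanSpace ℝ (Fin d))) q := rfl
    rw [this, hq]
    simp
    ring
  have hcont : ∀ (r : MvPolynomial (Fin d) ℝ) (s : ℝ), Continuous (fun x => ev r ⟨_, hmem s x⟩) := by
    intro r s
    exact (cont_eval r).comp ((rotE i j hij s).continuous.comp continuous_subtype_val)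
  have h := hasDerivAt_integral_of_dominated_loc_of_deriv_le (μ := τ) (𝕜 := ℝ)
    (F := fun s x => ev p ⟨_, hmem s x⟩) (F' := fun s x => - ev q ⟨_, hmem s x⟩) (x₀ := 0)
    (s := Set.univ) (bound := fun _ => C) Filter.univ_mem
    (Filter.Eventually.of_forall fun s => (hcont p s).aestronglyMeasurable)
    (int_cont τ _ (hcont p 0)) (hcont q 0).neg.aestronglyMeasurable
    (ae_of_all _ fun x s _ => by simpa using hC _) (integrable_const _)
    (ae_of_all _ fun x s _ => hder x s)
  have h2 := h.2
  have hconst : (fun s => ∫ x, ev p ⟨_, hmem s x⟩ ∂τ) = fun _ => ∫ x, ev p x ∂τ := by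
    ext s
    exact hinv (rotE i j hij s) _ (cont_eval p)
  rw [hconst] at h2
  have h3 := h2.unique (hasDerivAt_const _ _)
  rw [integral_neg, neg_eq_zero] at h3
  have h4 : ∀ x, ev q ⟨_, hmem 0 x⟩ = ev q x := by
    intro x
    show MvPolynomial.eval (rotF i j 0 (x : EuclideanSpace ℝ (Fin d))) q = _
    congr 2
    ext l
    simp only [rotF, Real.cos_zero, Real.sin_zero]
    split_ifs with h1 h2
    · subst h1; ring
    · subst h2; ring
    · rfl
  simp_rw [h4] at h3
  exact h3

theorem basic (τ : Measure (Metric.sphere (0 : EuclideanSpace ℝ (Fin d)) 1))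
    [IsProbabilityMeasure τ] (hinv : Inv τ) (i : Fin d) (p : MvPolynomial (Fin d) ℝ) (m : ℕ)
    (hp : p.IsHomogeneous m) :
    ∫ x, ev (MvPolynomial.pderiv i p) x ∂τ
      = ((m : ℝ) + d - 1) * ∫ x, ev (MvPolynomial.X i * p) x ∂τ := by
  have h0 : ∑ j : Fin d, ∫ x, ev (MvPolynomial.X j * MvPolynomial.pderiv i (MvPolynomial.X j * p)
      - MvPolynomial.X i * MvPolynomial.pderiv j (MvPolynomial.X j * p)) x ∂τ = 0 :=
    Finset.sum_eq_zero fun j _ => rot_zero τ hinv i j _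
  rw [← integral_finsetSum _ (fun j _ => int_ev τ _)] at h0
  have h1 : ∀ x, ∑ j : Fin d, ev (MvPolynomial.X j * MvPolynomial.pderiv i (MvPolynomial.X j * p)
      - MvPolynomial.X i * MvPolynomial.pderiv j (MvPolynomial.X j * p)) x
      = ev (MvPolynomial.pderiv i p) x - ((m : ℝ) + d - 1) * ev (MvPolynomial.X i * p) x := by
    intro x
    have hx : ∑ j, (x : EuclideanSpace ℝ (Fin d)) j ^ 2 = 1 := by
      have := x.2
      rw [mem_sphere_zero_iff_norm] at this
      rw [← EuclideanSpace.real_norm_sq_eq, this]; norm_num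
    have he := congrArg (ev · x) hp.sum_X_mul_pderiv
    simp only [ev, map_sum, map_mul, MvPolynomial.eval_X, nsmul_eq_mul, map_natCast] at he
    simp only [ev, Derivation.leibniz, MvPolynomial.pderiv_X, smul_eq_mul, map_sub, map_mul, map_add, MvPolynomial.eval_X]
    have e1 : ∀ j, (x : EuclideanSpace ℝ (Fin d)) j * ((x : EuclideanSpace ℝ (Fin d)) j * ev (MvPolynomial.pderiv i p) x
       + ev p x * MvPolynomial.eval (fun i => (x : EuclideanSpace ℝ (Fin d)) i) (Pi.single (M := fun _ => MvPolynomial (Fin d) ℝ) i 1 j))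
       - (x : EuclideanSpace ℝ (Fin d)) i * ((x : EuclideanSpace ℝ (Fin d)) j * ev (MvPolynomial.pderiv j p) x
       + ev p x * MvPolynomial.eval (fun i => (x : EuclideanSpace ℝ (Fin d)) i) (Pi.single (M := fun _ => MvPolynomial (Fin d) ℝ) j 1 j))
       = (x : EuclideanSpace ℝ (Fin d)) j ^ 2 * ev (MvPolynomial.pderiv i p) x
         + (if j = i then (x : EuclideanSpace ℝ (Fin d)) i * ev p x else 0)
         - (x : EuclideanSpace ℝ (Fin d)) i * ((x : EuclideanSpace ℝ (Fin d)) j * ev (MvPolynomial.pderiv j p) x)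
         - (x : EuclideanSpace ℝ (Fin d)) i * ev p x := by
      intro j
      by_cases hji : j = i
      · subst hji; simp; ring
      · rw [Pi.single_eq_of_ne hji]; simp [hji]; ring
    refine (Finset.sum_congr rfl fun j _ => e1 j).trans ?_
    simp only [Finset.sum_sub_distrib, Finset.sum_add_distrib, ← Finset.sum_mul, ← Finset.mul_sum,
      Finset.sum_ite_eq', Finset.mem_univ, if_true, Finset.sum_const, Finset.card_univ, Fintype.card_fin, hx, nsmul_eq_mul]
    simp only [ev, he]
    ring
  simp_rw [h1] at h0
  rw [integral_sub (int_ev τ _) ((int_ev τ _).const_mul _), integral_const_mul] at h0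
  linarith
end S11

namespace S11
open MeasureTheory
open scoped RealInnerProductSpace
variable {d : ℕ}

/-- the linear form `⟨·, θ⟩` as a polynomial -/
noncomputable def ip (θ : EuclideanSpace ℝ (Fin d)) : MvPolynomial (Fin d) ℝ :=
  ∑ i, MvPolynomial.C (θ i) * MvPolynomial.X i

theorem pderiv_comm' (i j : Fin d) (p : MvPolynomial (Fin d) ℝ) :
    MvPolynomial.pderiv i (MvPolynomial.pderiv j p) = MvPolynomial.pderiv j (MvPolynomial.pderiv i p) := by
  have h : ⁅MvPolynomial.pderiv (R := ℝ) i, MvPolynomial.pderiv (R := ℝ) j⁆ = 0 := by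
    apply MvPolynomial.derivation_ext
    intro l
    rw [Derivation.commutator_apply]
    simp only [MvPolynomial.pderiv_X, Pi.single_apply]
    split_ifs <;> simp
  have := congrArg (fun D => D p) h
  rw [Derivation.commutator_apply] at this
  simpa [sub_eq_zero] using this

theorem ip_hom (θ : EuclideanSpace ℝ (Fin d)) : (ip θ).IsHomogeneous 1 :=
  MvPolynomial.IsHomogeneous.sum _ _ _ fun _ _ => MvPolynomial.isHomogeneous_C_mul_X _ _

theorem ip_pow_hom (θ : EuclideanSpace ℝ (Fin d)) (n : ℕ) : (ip θ ^ n).IsHomogeneous n := by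
  simpa using (ip_hom θ).pow n

theorem pderiv_ip (θ : EuclideanSpace ℝ (Fin d)) (i : Fin d) :
    MvPolynomial.pderiv i (ip θ) = MvPolynomial.C (θ i) := by
  simp only [ip, map_sum, MvPolynomial.pderiv_C_mul, MvPolynomial.pderiv_X]
  rw [Finset.sum_eq_single i]
  · simp
  · intro b _ hb
    rw [Pi.single_eq_of_ne hb]; simp
  · simp

theorem pderiv_ip_pow (θ : EuclideanSpace ℝ (Fin d)) (i : Fin d) (n : ℕ) :
    MvPolynomial.pderiv i (ip θ ^ n) = MvPolynomial.C (n * θ i) * ip θ ^ (n - 1) := by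
  rw [MvPolynomial.pderiv_pow, pderiv_ip]; simp; ring

theorem ev_ip (θ : EuclideanSpace ℝ (Fin d)) (x : Metric.sphere (0 : EuclideanSpace ℝ (Fin d)) 1) :
    ev (ip θ) x = ⟪(x : EuclideanSpace ℝ (Fin d)), θ⟫ := by
  simp [ev, ip, PiLp.inner_apply]

theorem ev_mul (p q : MvPolynomial (Fin d) ℝ) (x) : ev (p * q) x = ev p x * ev q x := by simp [ev]
theorem ev_add (p q : MvPolynomial (Fin d) ℝ) (x) : ev (p + q) x = ev p x + ev q x := by simp [ev]
theorem ev_pow (p : MvPolynomial (Fin d) ℝ) (n : ℕ) (x) : ev (p ^ n) x = ev p x ^ n := by simp [ev]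
theorem ev_C (c : ℝ) (x : Metric.sphere (0 : EuclideanSpace ℝ (Fin d)) 1) :
    ev (MvPolynomial.C c) x = c := by simp [ev]
theorem ev_zero (x : Metric.sphere (0 : EuclideanSpace ℝ (Fin d)) 1) :
    ev 0 x = 0 := by simp [ev]
theorem ev_X (i) (x : Metric.sphere (0 : EuclideanSpace ℝ (Fin d)) 1) :
    ev (MvPolynomial.X i) x = (x : EuclideanSpace ℝ (Fin d)) i := by simp [ev]
theorem ev_sum {ι : Type*} (s : Finset ι) (f : ι → MvPolynomial (Fin d) ℝ) (x) :
    ev (∑ i ∈ s, f i) x = ∑ i ∈ s, ev (f i) x := by simp [ev]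

theorem sq_sum (θ : Metric.sphere (0 : EuclideanSpace ℝ (Fin d)) 1) :
    ∑ j, (θ : EuclideanSpace ℝ (Fin d)) j ^ 2 = 1 := by
  have := θ.2
  rw [mem_sphere_zero_iff_norm] at this
  rw [← EuclideanSpace.real_norm_sq_eq, this]; norm_num

theorem moment_rec (τ : Measure (Metric.sphere (0 : EuclideanSpace ℝ (Fin d)) 1))
    [IsProbabilityMeasure τ] (hinv : Inv τ) (θ : Metric.sphere (0 : EuclideanSpace ℝ (Fin d)) 1)
    (n : ℕ) :
    (n : ℝ) * ∫ x, ev (ip θ) x ^ (n - 1) ∂τ = ((n : ℝ) + d - 1) * ∫ x, ev (ip θ) x ^ (n + 1) ∂τ := by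
  have h : ∑ i, (θ : EuclideanSpace ℝ (Fin d)) i * ∫ x, ev (MvPolynomial.pderiv i (ip θ ^ n)) x ∂τ
    = ∑ i, (θ : EuclideanSpace ℝ (Fin d)) i * (((n : ℝ) + d - 1) * ∫ x, ev (MvPolynomial.X i * ip θ ^ n) x ∂τ) :=
    Finset.sum_congr rfl fun i _ => by rw [basic τ hinv i _ n (ip_pow_hom _ _)]
  have l : ∑ i, (θ : EuclideanSpace ℝ (Fin d)) i * ∫ x, ev (MvPolynomial.pderiv i (ip θ ^ n)) x ∂τ
      = (n : ℝ) * ∫ x, ev (ip θ) x ^ (n - 1) ∂τ := by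
    have : ∀ i, (θ : EuclideanSpace ℝ (Fin d)) i * ∫ x, ev (MvPolynomial.pderiv i (ip θ ^ n)) x ∂τ
        = (θ : EuclideanSpace ℝ (Fin d)) i ^ 2 * (n * ∫ x, ev (ip θ) x ^ (n - 1) ∂τ) := by
      intro i
      simp_rw [pderiv_ip_pow, ev_mul, ev_C, ev_pow, integral_const_mul]
      ring
    simp_rw [this, ← Finset.sum_mul, sq_sum, one_mul]
  have r : ∑ i, (θ : EuclideanSpace ℝ (Fin d)) i * (((n : ℝ) + d - 1) * ∫ x, ev (MvPolynomial.X i * ip θ ^ n) x ∂τ)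
      = ((n : ℝ) + d - 1) * ∫ x, ev (ip θ) x ^ (n + 1) ∂τ := by
    have : ∀ x, ev (ip θ) x ^ (n + 1) = ∑ i, (θ : EuclideanSpace ℝ (Fin d)) i * ev (MvPolynomial.X i * ip θ ^ n) x := by
      intro x
      rw [pow_succ']
      nth_rewrite 1 [ip]
      rw [ev_sum, Finset.sum_mul]
      refine Finset.sum_congr rfl fun i _ => ?_
      simp only [ev_mul, ev_C, ev_pow]; ring
    simp_rw [this]
    rw [integral_finsetSum _ (fun j _ => (int_ev τ _).const_mul _), Finset.mul_sum]
    refine Finset.sum_congr rfl fun i _ => ?_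
    rw [integral_const_mul]; ring
  rw [← l, h, r]

theorem grad (τ : Measure (Metric.sphere (0 : EuclideanSpace ℝ (Fin d)) 1))
    [IsProbabilityMeasure τ] (hinv : Inv τ) (f g : MvPolynomial (Fin d) ℝ) (a b : ℕ)
    (hf : f.IsHomogeneous a) (hg : g.IsHomogeneous b) :
    ∫ x, ev (∑ i, MvPolynomial.pderiv i f * MvPolynomial.pderiv i g) x ∂τ
      + ∫ x, ev (f * ∑ i, MvPolynomial.pderiv i (MvPolynomial.pderiv i g)) x ∂τ
      = b * ((a : ℝ) + b + d - 2) * ∫ x, ev (f * g) x ∂τ := by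
  have h : ∀ i, _ := fun i => basic τ hinv i (f * MvPolynomial.pderiv i g) (a + (b - 1)) (hf.mul hg.pderiv)
  have h2 := Finset.sum_congr (rfl : Finset.univ = Finset.univ) fun i _ => h i
  rw [← Finset.mul_sum, ← integral_finsetSum _ (fun j _ => int_ev τ _),
    ← integral_finsetSum _ (fun j _ => int_ev τ _)] at h2
  simp_rw [← ev_sum] at h2
  have e1 : ∑ i, MvPolynomial.X i * (f * MvPolynomial.pderiv i g) = MvPolynomial.C (b : ℝ) * (f * g) := by
    have : ∑ i, MvPolynomial.X i * (f * MvPolynomial.pderiv i g)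
      = f * ∑ i, MvPolynomial.X i * MvPolynomial.pderiv i g := by
      rw [Finset.mul_sum]; exact Finset.sum_congr rfl fun i _ => by ring
    rw [this, hg.sum_X_mul_pderiv]; simp; ring
  have e2 : ∑ i, MvPolynomial.pderiv i (f * MvPolynomial.pderiv i g)
      = ∑ i, MvPolynomial.pderiv i f * MvPolynomial.pderiv i g
        + f * ∑ i, MvPolynomial.pderiv i (MvPolynomial.pderiv i g) := by
    rw [Finset.mul_sum, ← Finset.sum_add_distrib]
    exact Finset.sum_congr rfl fun i _ => by simp [Derivation.leibniz]; ring
  rw [e1, e2] at h2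
  simp_rw [ev_add, ev_mul (MvPolynomial.C _), ev_C] at h2
  rw [integral_add (int_ev τ _) (int_ev τ _), integral_const_mul] at h2
  rw [h2]
  rcases Nat.eq_zero_or_pos b with hb | hb
  · simp [hb]
  · push_cast [Nat.cast_sub hb]; ring

theorem Q_rec (τ : Measure (Metric.sphere (0 : EuclideanSpace ℝ (Fin d)) 1))
    [IsProbabilityMeasure τ] (hinv : Inv τ) (θ : Metric.sphere (0 : EuclideanSpace ℝ (Fin d)) 1)
    (h : MvPolynomial (Fin d) ℝ) (k : ℕ) (hh : h.IsHomogeneous k)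
    (hΔ : ∑ i : Fin d, MvPolynomial.pderiv i (MvPolynomial.pderiv i h) = 0) (n : ℕ) :
    ((n : ℝ) - k) * ((n : ℝ) + k + d - 2) * ∫ x, ev (ip θ ^ n * h) x ∂τ
      = n * (n - 1) * ∫ x, ev (ip θ ^ (n - 2) * h) x ∂τ := by
  have h1 := grad τ hinv (ip θ ^ n) h n k (ip_pow_hom _ _) hh
  have h2 := grad τ hinv h (ip θ ^ n) k n hh (ip_pow_hom _ _)
  have e : ∑ i : Fin d, MvPolynomial.pderiv i (MvPolynomial.pderiv i (ip (θ : EuclideanSpace ℝ (Fin d)) ^ n))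
      = MvPolynomial.C ((n : ℝ) * (n - 1)) * ip θ ^ (n - 2) := by
    have : ∀ i, MvPolynomial.pderiv i (MvPolynomial.pderiv i (ip (θ : EuclideanSpace ℝ (Fin d)) ^ n))
      = MvPolynomial.C ((θ : EuclideanSpace ℝ (Fin d)) i ^ 2) * (MvPolynomial.C ((n : ℝ) * (n - 1)) * ip θ ^ (n - 2)) := by
      intro i
      rw [pderiv_ip_pow, MvPolynomial.pderiv_C_mul, pderiv_ip_pow, ← mul_assoc, ← mul_assoc, ← map_mul, ← map_mul, Nat.sub_sub]
      congr 2
      rcases Nat.eq_zero_or_pos n with hb | hb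
      · simp [hb]
      · push_cast [Nat.cast_sub hb]; ring
    simp_rw [this]
    rw [← Finset.sum_mul, ← map_sum, sq_sum]; simp
  rw [hΔ] at h1
  rw [e] at h2
  have e3 : h * (MvPolynomial.C ((n : ℝ) * (n - 1)) * ip (θ : EuclideanSpace ℝ (Fin d)) ^ (n - 2))
    = MvPolynomial.C ((n : ℝ) * (n - 1)) * (ip θ ^ (n - 2) * h) := by ring
  rw [e3, mul_comm h] at h2
  simp_rw [ev_mul (MvPolynomial.C _), ev_C, integral_const_mul] at h2
  simp only [mul_zero, ev_zero, integral_zero, add_zero] at h1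
  simp_rw [mul_comm (MvPolynomial.pderiv _ h)] at h2
  rw [h1] at h2
  linear_combination (-1 : ℝ) * h2

theorem Q_top (τ : Measure (Metric.sphere (0 : EuclideanSpace ℝ (Fin d)) 1))
    [IsProbabilityMeasure τ] (hinv : Inv τ) (θ : Metric.sphere (0 : EuclideanSpace ℝ (Fin d)) 1)
    (k : ℕ) : ∀ (h : MvPolynomial (Fin d) ℝ) (_ : h.IsHomogeneous k)
    (_ : ∑ i : Fin d, MvPolynomial.pderiv i (MvPolynomial.pderiv i h) = 0),
    (∏ j ∈ Finset.range k, (2 * (j : ℝ) + d)) * ∫ x, ev (ip θ ^ k * h) x ∂τ = k.factorial * ev h θ := by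
  induction k with
  | zero =>
    intro h hh _
    have := hh.totalDegree_le
    obtain ⟨c, rfl⟩ : ∃ c, h = MvPolynomial.C c :=
      ⟨_, MvPolynomial.totalDegree_eq_zero_iff_eq_C.1 (Nat.le_zero.1 this)⟩
    simp [ev_C]
  | succ k ih =>
    intro h hh hΔ
    have h1 := grad τ hinv (ip θ ^ (k + 1)) h (k + 1) (k + 1) (ip_pow_hom _ _) hh
    set h' : MvPolynomial (Fin d) ℝ := ∑ i, MvPolynomial.C ((θ : EuclideanSpace ℝ (Fin d)) i) * MvPolynomial.pderiv i h with hh'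
    have h'hom : h'.IsHomogeneous k := by
      refine MvPolynomial.IsHomogeneous.sum _ _ _ fun i _ => ?_
      simpa using (MvPolynomial.isHomogeneous_C (Fin d) ((θ : EuclideanSpace ℝ (Fin d)) i)).mul (hh.pderiv (i := i))
    have h'Δ : ∑ i : Fin d, MvPolynomial.pderiv i (MvPolynomial.pderiv i h') = 0 := by
      simp only [hh', map_sum, MvPolynomial.pderiv_C_mul]
      rw [Finset.sum_comm]
      refine Finset.sum_eq_zero fun j _ => ?_
      rw [← Finset.mul_sum]
      have : ∀ i, MvPolynomial.pderiv i (MvPolynomial.pderiv i (MvPolynomial.pderiv j h))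
        = MvPolynomial.pderiv j (MvPolynomial.pderiv i (MvPolynomial.pderiv i h)) := by
        intro i
        rw [pderiv_comm' i j, pderiv_comm' i j]
      simp_rw [this]
      rw [← map_sum, hΔ]; simp
    have e : ∑ i, MvPolynomial.pderiv i (ip (θ : EuclideanSpace ℝ (Fin d)) ^ (k + 1)) * MvPolynomial.pderiv i h
      = MvPolynomial.C ((k : ℝ) + 1) * (ip θ ^ k * h') := by
      rw [hh', Finset.mul_sum, Finset.mul_sum]
      refine Finset.sum_congr rfl fun i _ => ?_
      rw [pderiv_ip_pow]
      simp only [Nat.add_sub_cancel, map_mul]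
      push_cast
      ring
    have ihh := ih h' h'hom h'Δ
    have eul : ev h' θ = (k + 1) * ev h θ := by
      have := congrArg (ev · θ) hh.sum_X_mul_pderiv
      simp only [ev_sum, ev_mul, ev_X] at this
      rw [hh', ev_sum]
      simp only [ev_mul, ev_C]
      rw [this]
      simp [ev]
    rw [hΔ, e] at h1
    simp only [mul_zero, ev_zero, integral_zero, add_zero] at h1
    simp_rw [ev_mul (MvPolynomial.C _), ev_C, integral_const_mul] at h1
    have hk : (k : ℝ) + 1 ≠ 0 := by positivity
    have h3 : ∫ x, ev (ip θ ^ k * h') x ∂τ = (2 * (k : ℝ) + d) * ∫ x, ev (ip θ ^ (k + 1) * h) x ∂τ := by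
      apply mul_left_cancel₀ hk
      rw [h1]; push_cast; ring
    rw [h3, eul] at ihh
    rw [Finset.prod_range_succ, Nat.factorial_succ]
    push_cast
    linear_combination ihh

theorem Q_all (τ : Measure (Metric.sphere (0 : EuclideanSpace ℝ (Fin d)) 1))
    [IsProbabilityMeasure τ] (hinv : Inv τ) (hd : 2 ≤ d)
    (h : MvPolynomial (Fin d) ℝ) (k : ℕ) (hk : 1 ≤ k) (hh : h.IsHomogeneous k)
    (hΔ : ∑ i : Fin d, MvPolynomial.pderiv i (MvPolynomial.pderiv i h) = 0) (n : ℕ) :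
    ∃ c : ℝ, (n < k → c = 0) ∧ ∀ θ : Metric.sphere (0 : EuclideanSpace ℝ (Fin d)) 1,
      ∫ x, ev (ip θ ^ n * h) x ∂τ = c * ev h θ := by
  have hd' : (2 : ℝ) ≤ d := by exact_mod_cast hd
  have hk' : (1 : ℝ) ≤ k := by exact_mod_cast hk
  induction n using Nat.strong_induction_on with
  | _ n ih =>
    by_cases hn : n = k
    · subst hn
      refine ⟨n.factorial / (∏ j ∈ Finset.range n, (2 * (j : ℝ) + d)), fun h => absurd h (lt_irrefl _), fun θ => ?_⟩
      have hpos : (∏ j ∈ Finset.range n, (2 * (j : ℝ) + d)) ≠ 0 :=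
        (Finset.prod_pos fun j _ => by positivity).ne'
      have := Q_top τ hinv θ n h hh hΔ
      field_simp
      linarith
    · have hne : ((n : ℝ) - k) * ((n : ℝ) + k + d - 2) ≠ 0 := by
        apply mul_ne_zero
        · rw [sub_ne_zero]; exact_mod_cast hn
        · have : (0 : ℝ) ≤ n := Nat.cast_nonneg n
          linarith
      by_cases h2 : n < 2
      · refine ⟨0, fun _ => rfl, fun θ => ?_⟩
        have := Q_rec τ hinv θ h k hh hΔ n
        have h0 : (n : ℝ) * (n - 1) = 0 := by interval_cases n <;> simp
        rw [h0, zero_mul] at this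
        rw [zero_mul]
        exact (mul_eq_zero.1 this).resolve_left hne
      · obtain ⟨c, hc0, hc⟩ := ih (n - 2) (by omega)
        refine ⟨n * (n - 1) * c / (((n : ℝ) - k) * ((n : ℝ) + k + d - 2)), fun hlt => ?_, fun θ => ?_⟩
        · rw [hc0 (by omega)]; simp
        · have := Q_rec τ hinv θ h k hh hΔ n
          rw [hc θ] at this
          rw [eq_comm, div_mul_eq_mul_div, div_eq_iff hne]
          linarith
end S11

namespace S11
open MeasureTheory
open scoped RealInnerProductSpace
open Polynomial in
theorem polyA {d : ℕ} (i0 j0 : Fin d) (p : MvPolynomial (Fin d) ℝ) :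
    ∃ A B : ℝ[X], ∀ s t : ℝ, s ^ 2 + t ^ 2 = 1 →
      MvPolynomial.eval (fun l => if l = j0 then t else if l = i0 then s else 0) p
        = A.eval t + s * B.eval t := by
  induction p using MvPolynomial.induction_on with
  | C a => exact ⟨C a, 0, fun s t _ => by simp⟩
  | add p q hp hq =>
    obtain ⟨A, B, h⟩ := hp
    obtain ⟨A', B', h'⟩ := hq
    exact ⟨A + A', B + B', fun s t hst => by rw [map_add, h s t hst, h' s t hst]; simp; ring⟩
  | mul_X p l hp =>
    obtain ⟨A, B, h⟩ := hp
    by_cases h1 : l = j0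
    · exact ⟨A * X, B * X, fun s t hst => by rw [map_mul, h s t hst]; simp [h1]; ring⟩
    · by_cases h2 : l = i0
      · refine ⟨(1 - X ^ 2) * B, A, fun s t hst => ?_⟩
        rw [map_mul, h s t hst, MvPolynomial.eval_X, if_neg h1, if_pos h2]
        simp
        linear_combination (B.eval t) * hst
      · exact ⟨0, 0, fun s t hst => by simp [h1, h2]⟩

section
open Polynomial

theorem coeff_X_der (B : ℝ[X]) (j : ℕ) : (X * derivative B).coeff j = j * B.coeff j := by
  cases j with
  | zero => simp
  | succ j => rw [coeff_X_mul, coeff_derivative]; push_cast; ring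

theorem ode_coeff (A : ℝ[X]) (d k : ℝ)
    (hode : (1 - X ^ 2) * derivative (derivative A) - C (d - 1) * X * derivative A
      + C (k * (k + d - 2)) * A = 0) (j : ℕ) :
    ((j : ℝ) + 1) * (2 * j + d - 1) * (taylor 1 A).coeff (j + 1)
      = (k - j) * (k + j + d - 2) * (taylor 1 A).coeff j := by
  set B := taylor 1 A with hB
  have hB' : derivative B = (derivative A).comp (X + C 1) := by
    rw [hB, taylor_apply, derivative_comp]; simp
  have hB'' : derivative (derivative B) = (derivative (derivative A)).comp (X + C 1) := by
    rw [hB', derivative_comp]; simp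
  have h := congrArg (fun p => p.comp (X + C 1)) hode
  simp only [add_comp, sub_comp, mul_comp, one_comp, pow_comp, X_comp, C_comp, zero_comp] at h
  rw [← hB', ← hB'', ← taylor_apply, ← hB] at h
  have h2 : - (X * (X * derivative (derivative B))) - C 2 * (X * derivative (derivative B))
    - C (d - 1) * (X * derivative B) - C (d - 1) * derivative B + C (k * (k + d - 2)) * B = 0 := by
    rw [← h]
    have : (C 2 : ℝ[X]) = 2 := rfl
    rw [this, C_1]
    ring
  have h3 := congrArg (fun p => p.coeff j) h2
  simp only [coeff_add, coeff_sub, coeff_neg, coeff_C_mul, coeff_X_der, coeff_derivative, coeff_zero] at h3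
  have h4 : (X * (X * derivative (derivative B))).coeff j = j * (j - 1) * B.coeff j := by
    cases j with
    | zero => simp
    | succ j => rw [coeff_X_mul, coeff_X_der, coeff_derivative]; push_cast; ring
  rw [h4] at h3
  linear_combination (-1 : ℝ) * h3

theorem lam1 (Λ : ℝ[X] →ₗ[ℝ] ℝ) (d : ℝ)
    (hM : ∀ n : ℕ, (n : ℝ) * Λ (X ^ (n - 1)) = (n + d - 1) * Λ (X ^ (n + 1))) (u : ℝ[X]) :
    Λ ((1 - X ^ 2) * derivative u - C (d - 1) * X * u) = 0 := by
  induction u using Polynomial.induction_on' with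
  | add p q hp hq =>
    rw [show (1 - X ^ 2) * derivative (p + q) - C (d - 1) * X * (p + q)
      = ((1 - X ^ 2) * derivative p - C (d - 1) * X * p) + ((1 - X ^ 2) * derivative q - C (d - 1) * X * q) by
        rw [derivative_add]; ring, map_add, hp, hq, add_zero]
  | monomial n a =>
    have e : (1 - X ^ 2) * derivative (monomial n a) - C (d - 1) * X * monomial n a
      = a • ((n : ℝ) • X ^ (n - 1) - ((n : ℝ) + d - 1) • X ^ (n + 1)) := by
      rw [derivative_monomial]
      simp only [← C_mul_X_pow_eq_monomial, smul_eq_C_mul, map_sub, map_add, map_mul, C_1]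
      cases n with
      | zero => simp; ring
      | succ n => simp only [Nat.add_sub_cancel]; ring
    rw [e, map_smul, map_sub, map_smul, map_smul, smul_eq_mul, smul_eq_mul, smul_eq_mul, hM]
    ring

theorem lam2 (Λ : ℝ[X] →ₗ[ℝ] ℝ) (d k : ℝ) (A : ℝ[X])
    (hQ : ∀ n : ℕ, ((n : ℝ) - k) * (n + k + d - 2) * Λ (X ^ n * A)
      = n * (n - 1) * Λ (X ^ (n - 2) * A)) (u : ℝ[X]) :
    Λ (((1 - X ^ 2) * derivative (derivative u) - C (d - 1) * X * derivative u
      + C (k * (k + d - 2)) * u) * A) = 0 := by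
  induction u using Polynomial.induction_on' with
  | add p q hp hq =>
    rw [show ((1 - X ^ 2) * derivative (derivative (p + q)) - C (d - 1) * X * derivative (p + q)
        + C (k * (k + d - 2)) * (p + q)) * A
      = ((1 - X ^ 2) * derivative (derivative p) - C (d - 1) * X * derivative p
        + C (k * (k + d - 2)) * p) * A + ((1 - X ^ 2) * derivative (derivative q)
        - C (d - 1) * X * derivative q + C (k * (k + d - 2)) * q) * A by
        simp only [derivative_add]; ring, map_add, hp, hq, add_zero]
  | monomial n a =>
    have e : ((1 - X ^ 2) * derivative (derivative (monomial n a)) - C (d - 1) * X * derivative (monomial n a)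
        + C (k * (k + d - 2)) * monomial n a) * A
      = a • (((n : ℝ) * (n - 1)) • (X ^ (n - 2) * A) - (((n : ℝ) - k) * (n + k + d - 2)) • (X ^ n * A)) := by
      have h2 : (C (2 : ℝ) : ℝ[X]) = 2 := rfl
      rw [derivative_monomial, derivative_monomial]
      simp only [← C_mul_X_pow_eq_monomial, smul_eq_C_mul, map_sub, map_add, map_mul, C_1, h2]
      rcases n with _ | _ | n
      · simp; ring
      · simp; ring
      · simp only [Nat.add_sub_cancel, Nat.cast_add, map_add, Nat.cast_one, C_1]
        rw [show n + 1 + 1 - 2 = n by omega]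
        ring
    rw [e, map_smul, map_sub, map_smul, map_smul, smul_eq_mul, smul_eq_mul, smul_eq_mul, hQ]
    ring

theorem lam3 (Λ : ℝ[X] →ₗ[ℝ] ℝ) (d k : ℝ) (A : ℝ[X])
    (hM : ∀ n : ℕ, (n : ℝ) * Λ (X ^ (n - 1)) = (n + d - 1) * Λ (X ^ (n + 1)))
    (hQ : ∀ n : ℕ, ((n : ℝ) - k) * (n + k + d - 2) * Λ (X ^ n * A)
      = n * (n - 1) * Λ (X ^ (n - 2) * A)) (q : ℝ[X]) :
    Λ (((1 - X ^ 2) * derivative (derivative A) - C (d - 1) * X * derivative A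
      + C (k * (k + d - 2)) * A) * q) = 0 := by
  have h1 := lam1 Λ d hM (derivative q * A)
  have h2 := lam1 Λ d hM (derivative A * q)
  have h3 := lam2 Λ d k A hQ q
  have : ((1 - X ^ 2) * derivative (derivative A) - C (d - 1) * X * derivative A
      + C (k * (k + d - 2)) * A) * q
    = ((1 - X ^ 2) * derivative (derivative A * q) - C (d - 1) * X * (derivative A * q))
      - ((1 - X ^ 2) * derivative (derivative q * A) - C (d - 1) * X * (derivative q * A))
      + ((1 - X ^ 2) * derivative (derivative q) - C (d - 1) * X * derivative q
      + C (k * (k + d - 2)) * q) * A := by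
    simp only [derivative_mul]; ring
  rw [this, map_add, map_sub, h1, h2, h3]; ring

theorem prodfact (e k : ℕ) : (∏ j ∈ Finset.range k, (((2 * j : ℝ) + (e + 2 : ℕ) - 1) * (2 * (j : ℝ) + (e + 2 : ℕ)))) * (e.factorial : ℝ)
    = ((2 * k + e).factorial : ℝ) := by
  induction k with
  | zero => simp
  | succ k ih =>
    rw [Finset.prod_range_succ, mul_right_comm, ih]
    rw [show 2 * (k + 1) + e = (2 * k + e + 1) + 1 by ring, Nat.factorial_succ, Nat.factorial_succ]
    push_cast; ring

theorem prodfact2 (m k : ℕ) : (∏ j ∈ Finset.range k, ((m : ℝ) + 1 + j)) * (m.factorial : ℝ) = ((m + k).factorial : ℝ) := by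
  induction k with
  | zero => simp
  | succ k ih =>
    rw [Finset.prod_range_succ, mul_right_comm, ih]
    rw [← add_assoc, Nat.factorial_succ]
    push_cast; ring

theorem prodfact3 (k : ℕ) : (∏ j ∈ Finset.range k, ((k : ℝ) - j)) = ∏ j ∈ Finset.range k, ((j : ℝ) + 1) := by
  rw [← Finset.prod_range_reflect]
  refine Finset.prod_congr rfl fun j hj => ?_
  have : j + 1 ≤ k := Finset.mem_range.1 hj
  rw [show k - 1 - j = k - (j + 1) by omega, Nat.cast_sub this]; push_cast; ring

theorem final_const (d k : ℕ) (hd : 2 ≤ d) (hk : 1 ≤ k) (β : ℕ → ℝ) (h0 : β 0 = 1)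
    (hrec : ∀ j : ℕ, ((j : ℝ) + 1) * (2 * j + d - 1) * β (j + 1) = (k - j) * (k + j + d - 2) * β j)
    (Q I : ℝ) (hQ : (∏ j ∈ Finset.range k, (2 * (j : ℝ) + d)) * Q = k.factorial) (hI : I = β k * Q) :
    I * ((((2 * k + d - 2) * Nat.factorial (k + d - 3) : ℕ) : ℝ)
          / ((Nat.factorial k * Nat.factorial (d - 2) : ℕ) : ℝ)) = 1 := by
  obtain ⟨e, rfl⟩ : ∃ e, d = e + 2 := ⟨d - 2, by omega⟩
  obtain ⟨k, rfl⟩ : ∃ k', k = k' + 1 := ⟨k - 1, by omega⟩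
  set K := k + 1 with hK
  have hβ : ∀ n, (∏ j ∈ Finset.range n, (((j : ℝ) + 1) * (2 * j + (e + 2 : ℕ) - 1))) * β n
      = ∏ j ∈ Finset.range n, (((K : ℝ) - j) * (K + j + (e + 2 : ℕ) - 2)) := by
    intro n
    induction n with
    | zero => simp [h0]
    | succ n ih =>
      rw [Finset.prod_range_succ, Finset.prod_range_succ, ← ih, mul_assoc, hrec]; ring
  have h1 := hβ K
  rw [Finset.prod_mul_distrib, Finset.prod_mul_distrib, prodfact3, mul_assoc] at h1
  have hp : (∏ j ∈ Finset.range K, ((j : ℝ) + 1)) ≠ 0 := (Finset.prod_pos fun j _ => by positivity).ne'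
  have h2 := mul_left_cancel₀ hp h1
  have h3 := prodfact e K
  rw [Finset.prod_mul_distrib] at h3
  have h4 := prodfact2 (k + e) K
  have h5 : ∏ j ∈ Finset.range K, ((K : ℝ) + j + (e + 2 : ℕ) - 2) = ∏ j ∈ Finset.range K, (((k + e : ℕ) : ℝ) + 1 + j) := by
    refine Finset.prod_congr rfl fun j _ => ?_
    rw [hK]; push_cast; ring
  rw [h5] at h2
  rw [show 2 * K + (e + 2) - 2 = 2 * K + e by omega, show K + (e + 2) - 3 = k + e by omega,
    show e + 2 - 2 = e by omega, hI]
  rw [show 2 * K + e = (k + e + K) + 1 by omega] at h3 ⊢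
  rw [Nat.factorial_succ] at h3
  set a := ∏ j ∈ Finset.range K, ((2 : ℝ) * j + (e + 2 : ℕ) - 1)
  set b := ∏ j ∈ Finset.range K, ((2 : ℝ) * j + (e + 2 : ℕ))
  set c := ∏ j ∈ Finset.range K, (((k + e : ℕ) : ℝ) + 1 + j)
  have hF : ((k + e + K).factorial : ℝ) ≠ 0 := by positivity
  have hK0 : (K.factorial : ℝ) ≠ 0 := by positivity
  have he0 : (e.factorial : ℝ) ≠ 0 := by positivity
  have hab : a * b ≠ 0 := by
    intro h0
    rw [h0, zero_mul] at h3
    have : (0 : ℝ) < (((k + e + K + 1) * (k + e + K).factorial : ℕ) : ℝ) := by positivity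
    linarith
  push_cast at h3 ⊢
  rw [← mul_div_assoc, div_eq_one_iff_eq (mul_ne_zero hK0 he0)]
  apply mul_left_cancel₀ hab
  have h6 : a * b * (β K * Q * (((k : ℝ) + e + K + 1) * (k + e).factorial))
    = (a * β K) * (b * Q) * (((k : ℝ) + e + K + 1) * (k + e).factorial) := by ring
  rw [h6, h2, hQ]
  linear_combination (K.factorial : ℝ) * ((k : ℝ) + e + K + 1) * h4 - (K.factorial : ℝ) * h3
end
end S11

namespace S11
open MeasureTheory
open scoped RealInnerProductSpace

theorem int_bdd (μ : Measure ℝ) [IsFiniteMeasure μ] (hμ : ∀ᵐ t ∂μ, t ∈ Set.Icc (-1 : ℝ) 1)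
    (f : ℝ → ℝ) (hf : Continuous f) : Integrable f μ := by
  obtain ⟨C, hC⟩ := (isCompact_Icc.image hf (s := Set.Icc (-1 : ℝ) 1)).isBounded.exists_norm_le
  refine Integrable.of_bound hf.aestronglyMeasurable C ?_
  filter_upwards [hμ] with t ht using hC _ ⟨t, ht, rfl⟩

theorem moment_ext (μ ν : Measure ℝ) [IsFiniteMeasure μ] [IsFiniteMeasure ν]
    (hμ : ∀ᵐ t ∂μ, t ∈ Set.Icc (-1 : ℝ) 1) (hν : ∀ᵐ t ∂ν, t ∈ Set.Icc (-1 : ℝ) 1)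
    (h : ∀ n : ℕ, ∫ t, t ^ n ∂μ = ∫ t, t ^ n ∂ν) : μ = ν := by
  have hpoly : ∀ p : Polynomial ℝ, ∫ t, p.eval t ∂μ = ∫ t, p.eval t ∂ν := by
    intro p
    simp_rw [Polynomial.eval_eq_sum_range]
    rw [integral_finsetSum _ fun i _ => int_bdd μ hμ _ (by fun_prop),
      integral_finsetSum _ fun i _ => int_bdd ν hν _ (by fun_prop)]
    simp_rw [integral_const_mul, h]
  apply ext_of_forall_integral_eq_of_IsFiniteMeasure
  intro f
  have key : ∀ ε > 0, |∫ t, f t ∂μ - ∫ t, f t ∂ν| ≤ ε * (μ.real Set.univ + ν.real Set.univ) := by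
    intro ε hε
    obtain ⟨p, hp⟩ := exists_polynomial_near_of_continuousOn (-1) 1 f f.continuous.continuousOn ε hε
    have hb : ∀ (ρ : Measure ℝ) [IsFiniteMeasure ρ], (∀ᵐ t ∂ρ, t ∈ Set.Icc (-1 : ℝ) 1) →
        |∫ t, p.eval t ∂ρ - ∫ t, f t ∂ρ| ≤ ε * ρ.real Set.univ := by
      intro ρ _ hρ
      rw [← integral_sub (int_bdd ρ hρ _ p.continuous) (int_bdd ρ hρ _ f.continuous)]
      refine norm_integral_le_of_norm_le_const (f := fun t => p.eval t - f t) ?_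
      filter_upwards [hρ] with t ht using (hp t ht).le
    have h1 := hb μ hμ
    have h2 := hb ν hν
    rw [hpoly p] at h1
    rw [abs_le] at h1 h2 ⊢
    constructor <;> linarith [h1.1, h1.2, h2.1, h2.2]
  have : |∫ t, f t ∂μ - ∫ t, f t ∂ν| ≤ 0 := by
    refine le_of_forall_pos_le_add fun ε hε => ?_
    have hT : 0 ≤ μ.real Set.univ + ν.real Set.univ := by positivity
    have := key (ε / (μ.real Set.univ + ν.real Set.univ + 1)) (by positivity)
    refine this.trans ?_
    rw [zero_add, div_mul_eq_mul_div, div_le_iff₀ (by positivity)]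
    nlinarith
  exact sub_eq_zero.1 (abs_nonpos_iff.1 this)

/-- the weight -/
noncomputable def w (d : ℕ) (t : ℝ) : ℝ := (1 - t ^ 2) ^ (((d : ℝ) - 3) / 2)

theorem w_meas (d : ℕ) : Measurable (w d) := by unfold w; fun_prop

theorem w_pos (d : ℕ) (t : ℝ) (ht : t ∈ Set.Ioo (-1 : ℝ) 1) : 0 < w d t :=
  Real.rpow_pos_of_pos (by nlinarith [ht.1, ht.2]) _

theorem w_nonneg (d : ℕ) (t : ℝ) (ht : t ∈ Set.Icc (-1 : ℝ) 1) : 0 ≤ w d t :=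
  Real.rpow_nonneg (by nlinarith [ht.1, ht.2]) _

theorem w_int (d : ℕ) (hd : 2 ≤ d) : IntervalIntegrable (w d) volume (-1) 1 := by
  rcases Nat.lt_or_ge d 3 with h | h
  · obtain rfl : d = 2 := by omega
    rw [intervalIntegrable_iff_integrableOn_Ioc_of_le (by norm_num)]
    refine intervalIntegral.integrableOn_deriv_of_nonneg (g := Real.arcsin)
      Real.continuous_arcsin.continuousOn (fun x hx => ?_) (fun x hx => (w_pos 2 x hx).le)
    refine (Real.hasDerivAt_arcsin hx.1.ne' hx.2.ne).congr_deriv ?_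
    have : 0 < 1 - x ^ 2 := by nlinarith [hx.1, hx.2]
    rw [w, Real.sqrt_eq_rpow, one_div, ← Real.rpow_neg this.le]
    norm_num
  · apply Continuous.intervalIntegrable
    unfold w
    have h3 : (3 : ℝ) ≤ d := by exact_mod_cast h
    exact Continuous.rpow_const (by fun_prop) fun x => Or.inr (by linarith)

theorem w_rec (d : ℕ) (hd : 2 ≤ d) (n : ℕ) :
    (n : ℝ) * ∫ t in (-1 : ℝ)..1, t ^ (n - 1) * w d t
      = ((n : ℝ) + d - 1) * ∫ t in (-1 : ℝ)..1, t ^ (n + 1) * w d t := by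
  have hd' : (2 : ℝ) ≤ d := by exact_mod_cast hd
  have hi : ∀ m : ℕ, IntervalIntegrable (fun t => t ^ m * w d t) volume (-1) 1 := fun m =>
    (w_int d hd).continuousOn_mul (by fun_prop)
  have h := intervalIntegral.integral_eq_sub_of_hasDerivAt_of_le (a := -1) (b := 1)
    (f := fun t : ℝ => t ^ n * (1 - t ^ 2) ^ (((d : ℝ) - 1) / 2))
    (f' := fun t => n * (t ^ (n - 1) * w d t) - ((n : ℝ) + d - 1) * (t ^ (n + 1) * w d t))
    (by norm_num) (by
      apply Continuous.continuousOn
      exact (continuous_pow n).mul (Continuous.rpow_const (by fun_prop) fun x => Or.inr (by linarith)))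
    (by
      intro x hx
      have hpos : 0 < 1 - x ^ 2 := by nlinarith [hx.1, hx.2]
      have h1 : HasDerivAt (fun t : ℝ => 1 - t ^ 2) (-(2 * x)) x := by
        simpa using (hasDerivAt_pow 2 x).const_sub 1
      have h2 := h1.rpow_const (p := ((d : ℝ) - 1) / 2) (Or.inl hpos.ne')
      refine ((hasDerivAt_pow n x).fun_mul h2).congr_deriv ?_
      have e1 : (1 - x ^ 2) ^ (((d : ℝ) - 1) / 2) = (1 - x ^ 2) * w d x := by
        rw [w]
        nth_rewrite 2 [← Real.rpow_one (1 - x ^ 2)]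
        rw [← Real.rpow_add hpos]; congr 1; ring
      have e2 : (1 - x ^ 2) ^ (((d : ℝ) - 1) / 2 - 1) = w d x := by
        rw [w]; congr 1; ring
      rw [e1, e2]
      rcases n with _ | n
      · simp; ring
      · simp only [Nat.add_sub_cancel]; push_cast; ring)
    (((hi _).const_mul _).sub ((hi _).const_mul _))
  rw [intervalIntegral.integral_sub ((hi _).const_mul _) ((hi _).const_mul _),
    intervalIntegral.integral_const_mul, intervalIntegral.integral_const_mul] at h
  have hz : (0 : ℝ) ^ (((d : ℝ) - 1) / 2) = 0 := Real.zero_rpow (by linarith)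
  norm_num [hz] at h
  linarith

noncomputable def W (d : ℕ) : ℝ := ∫ t in (-1 : ℝ)..1, w d t

theorem W_pos (d : ℕ) (hd : 2 ≤ d) : 0 < W d :=
  intervalIntegral.intervalIntegral_pos_of_pos_on (w_int d hd) (fun x hx => w_pos d x hx) (by norm_num)

/-- the normalised weight measure -/
noncomputable def mm (d : ℕ) : Measure ℝ :=
  (volume.restrict (Set.Ioc (-1 : ℝ) 1)).withDensity (fun t => ENNReal.ofReal (w d t / W d))

theorem mm_supp (d : ℕ) : ∀ᵐ t ∂(mm d), t ∈ Set.Icc (-1 : ℝ) 1 := by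
  refine (withDensity_absolutelyContinuous _ _).ae_le ?_
  filter_upwards [ae_restrict_mem measurableSet_Ioc] with t ht using ⟨ht.1.le, ht.2⟩

theorem mm_integral (d : ℕ) (hd : 2 ≤ d) (f : ℝ → ℝ) :
    ∫ t, f t ∂(mm d) = (∫ t in (-1 : ℝ)..1, f t * w d t) / W d := by
  rw [mm, integral_withDensity_eq_integral_toReal_smul ((w_meas d).div_const _).ennreal_ofReal
    (ae_of_all _ fun _ => ENNReal.ofReal_lt_top), intervalIntegral.integral_of_le (by norm_num),
    ← integral_div]
  refine integral_congr_ae ?_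
  filter_upwards [ae_restrict_mem measurableSet_Ioc] with t ht
  rw [ENNReal.toReal_ofReal (div_nonneg (w_nonneg d t ⟨ht.1.le, ht.2⟩) (W_pos d hd).le), smul_eq_mul]
  ring

theorem mm_prob (d : ℕ) (hd : 2 ≤ d) : IsProbabilityMeasure (mm d) := by
  constructor
  rw [mm, withDensity_apply _ MeasurableSet.univ, Measure.restrict_univ,
    ← ofReal_integral_eq_lintegral_ofReal]
  · rw [integral_div, ← intervalIntegral.integral_of_le (by norm_num)]
    change ENNReal.ofReal (W d / W d) = 1
    rw [div_self (W_pos d hd).ne']; simp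
  · have := (intervalIntegrable_iff_integrableOn_Ioc_of_le (by norm_num)).1 (w_int d hd)
    exact this.div_const _
  · filter_upwards [ae_restrict_mem measurableSet_Ioc] with t ht
    exact div_nonneg (w_nonneg d t ⟨ht.1.le, ht.2⟩) (W_pos d hd).le

/-- `mm`-a.e. zero polynomials vanish -/
theorem mm_poly_zero (d : ℕ) (hd : 2 ≤ d) (p : Polynomial ℝ)
    (h : ∫ t, p.eval t * p.eval t ∂(mm d) = 0) : p = 0 := by
  have := mm_prob d hd
  by_contra hp
  have h1 := (integral_eq_zero_iff_of_nonneg (fun t => mul_self_nonneg _)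
    (int_bdd (mm d) (mm_supp d) _ (p.continuous.mul p.continuous))).1 h
  have hac : volume.restrict (Set.Ioo (-1 : ℝ) 1) ≪ mm d := by
    have : (volume.restrict (Set.Ioc (-1 : ℝ) 1)) ≪ mm d := by
      refine withDensity_absolutelyContinuous' ((w_meas d).div_const _).ennreal_ofReal.aemeasurable ?_
      rw [← Measure.restrict_congr_set Ioo_ae_eq_Ioc]
      filter_upwards [ae_restrict_mem measurableSet_Ioo] with t ht
      simpa using div_pos (w_pos d t ht) (W_pos d hd)
    rwa [← Measure.restrict_congr_set Ioo_ae_eq_Ioc] at this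
  have h2 : ∀ᵐ t ∂(volume.restrict (Set.Ioo (-1 : ℝ) 1)), p.eval t * p.eval t = 0 := hac.ae_le h1
  rw [ae_restrict_iff' measurableSet_Ioo] at h2
  have h3 : ∀ᵐ t : ℝ, t ∉ (p.rootSet ℝ) := by
    rw [ae_iff]
    simpa using (p.rootSet_finite ℝ).measure_zero volume
  have h4 : ∀ᵐ t : ℝ, t ∉ Set.Ioo (-1 : ℝ) 1 := by
    filter_upwards [h2, h3] with t ht ht' hm
    apply ht'
    rw [Polynomial.mem_rootSet]
    exact ⟨hp, by simpa using ht hm⟩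
  rw [ae_iff] at h4
  have h5 : volume (Set.Ioo (-1 : ℝ) 1) = 0 := by
    convert h4 using 2
    ext t; simp
  rw [Real.volume_Ioo] at h5
  norm_num at h5

theorem moments_unique (d : ℕ) (hd : 2 ≤ d) (M N : ℕ → ℝ) (h0 : M 0 = N 0)
    (hM : ∀ n : ℕ, (n : ℝ) * M (n - 1) = (n + d - 1) * M (n + 1))
    (hN : ∀ n : ℕ, (n : ℝ) * N (n - 1) = (n + d - 1) * N (n + 1)) (n : ℕ) : M n = N n := by
  have hd' : (2 : ℝ) ≤ d := by exact_mod_cast hd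
  induction n using Nat.strong_induction_on with
  | _ n ih =>
    rcases n with _ | n
    · exact h0
    · have hne : (n : ℝ) + d - 1 ≠ 0 := by
        have : (0 : ℝ) ≤ n := Nat.cast_nonneg n
        linarith
      apply mul_left_cancel₀ hne
      rw [← hM, ← hN, ih (n - 1) (by omega)]
end S11

namespace S11
open MeasureTheory
open scoped RealInnerProductSpace
variable {d : ℕ}

theorem ip_mem (θ x : Metric.sphere (0 : EuclideanSpace ℝ (Fin d)) 1) :
    ev (ip θ) x ∈ Set.Icc (-1 : ℝ) 1 := by
  rw [ev_ip]
  have h := abs_real_inner_le_norm (x : EuclideanSpace ℝ (Fin d)) (θ : EuclideanSpace ℝ (Fin d))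
  rw [mem_sphere_zero_iff_norm.1 x.2, mem_sphere_zero_iff_norm.1 θ.2, mul_one] at h
  exact abs_le.1 h

theorem push (τ : Measure (Metric.sphere (0 : EuclideanSpace ℝ (Fin d)) 1))
    [IsProbabilityMeasure τ] (hinv : Inv τ) (hd : 2 ≤ d)
    (θ : Metric.sphere (0 : EuclideanSpace ℝ (Fin d)) 1) :
    τ.map (ev (ip θ)) = mm d := by
  have := mm_prob d hd
  have hm : Measurable (ev (ip (θ : EuclideanSpace ℝ (Fin d)))) := (cont_ev _).measurable
  refine moment_ext _ _ ?_ (mm_supp d) ?_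
  · exact (ae_map_iff hm.aemeasurable (p := fun t => t ∈ Set.Icc (-1:ℝ) 1) measurableSet_Icc).2
      (ae_of_all _ fun x => ip_mem θ x)
  · intro n
    have h1 : ∀ n : ℕ, ∫ t, t ^ n ∂(τ.map (ev (ip θ))) = ∫ x, ev (ip θ) x ^ n ∂τ := fun n =>
      integral_map hm.aemeasurable (continuous_pow n).aestronglyMeasurable
    refine moments_unique d hd (fun n => ∫ t, t ^ n ∂(τ.map (ev (ip θ)))) (fun n => ∫ t, t ^ n ∂(mm d)) ?_ ?_ ?_ n
    · simp only [h1]; simp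
    · intro n
      simp only [h1]
      exact moment_rec τ hinv θ n
    · intro n
      simp only [mm_integral d hd]
      rw [← mul_div_assoc, ← mul_div_assoc, w_rec d hd n]

theorem int_push (τ : Measure (Metric.sphere (0 : EuclideanSpace ℝ (Fin d)) 1))
    [IsProbabilityMeasure τ] (hinv : Inv τ) (hd : 2 ≤ d)
    (θ : Metric.sphere (0 : EuclideanSpace ℝ (Fin d)) 1) (f : ℝ → ℝ)
    (hf : AEStronglyMeasurable f (mm d)) :
    ∫ x, f (ev (ip θ) x) ∂τ = ∫ t, f t ∂(mm d) := by
  rw [← push τ hinv hd θ, integral_map (cont_ev _).aemeasurable]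
  rwa [push τ hinv hd θ]

theorem FH (τ : Measure (Metric.sphere (0 : EuclideanSpace ℝ (Fin d)) 1))
    [IsProbabilityMeasure τ] (hinv : Inv τ) (hd : 2 ≤ d)
    (θ e : Metric.sphere (0 : EuclideanSpace ℝ (Fin d)) 1)
    (h : MvPolynomial (Fin d) ℝ) (k : ℕ) (hk : 1 ≤ k) (hh : h.IsHomogeneous k)
    (hΔ : ∑ i : Fin d, MvPolynomial.pderiv i (MvPolynomial.pderiv i h) = 0)
    (hb : ∀ x, |ev h x| ≤ 1) (he : ev h e = 1) (A : Polynomial ℝ)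
    (hA : ∀ x, ev h x = A.eval (ev (ip e) x))
    (σ : ℝ → ℝ) (C : ℝ) (hσ : ∀ t ∈ Set.Icc (-1 : ℝ) 1, |σ t| ≤ C)
    (hσm : AEStronglyMeasurable σ (mm d)) :
    ∫ x, σ (ev (ip θ) x) * ev h x ∂τ = ev h θ * ∫ t, σ t * A.eval t ∂(mm d) := by
  have := mm_prob d hd
  have hm : Measurable (ev (ip (θ : EuclideanSpace ℝ (Fin d)))) := (cont_ev _).measurable
  have hhm : Measurable (ev h) := (cont_ev _).measurable
  have hAm : Measurable (fun t => A.eval t) := A.continuous.measurable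
  have hAb : ∀ᵐ t ∂(mm d), |A.eval t| ≤ 1 := by
    rw [← push τ hinv hd e, ae_map_iff (cont_ev _).aemeasurable
      (measurableSet_le (by fun_prop) measurable_const)]
    exact ae_of_all _ fun x => by rw [← hA]; exact hb x
  set ρ := τ.withDensity (fun x => ENNReal.ofReal (1 + ev h x)) with hρ
  set μ2 := (mm d).withDensity (fun t => ENNReal.ofReal (1 + ev h θ * A.eval t)) with hμ2
  have hn1 : ∀ x, 0 ≤ 1 + ev h x := fun x => by linarith [(abs_le.1 (hb x)).1]
  have hn2 : ∀ᵐ t ∂(mm d), 0 ≤ 1 + ev h θ * A.eval t := by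
    filter_upwards [hAb] with t ht
    have : |ev h θ * A.eval t| ≤ 1 := by
      rw [abs_mul]; exact mul_le_one₀ (hb θ) (abs_nonneg _) ht
    linarith [(abs_le.1 this).1]
  have i1 : ∀ f : _ → ℝ, ∫ x, f x ∂ρ = ∫ x, (1 + ev h x) * f x ∂τ := by
    intro f
    rw [hρ, integral_withDensity_eq_integral_toReal_smul (by fun_prop)
      (ae_of_all _ fun _ => ENNReal.ofReal_lt_top)]
    refine integral_congr_ae (ae_of_all _ fun x => ?_)
    simp only [ENNReal.toReal_ofReal (hn1 x), smul_eq_mul]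
  have i2 : ∀ f : _ → ℝ, ∫ x, f x ∂μ2 = ∫ t, (1 + ev h θ * A.eval t) * f t ∂(mm d) := by
    intro f
    rw [hμ2, integral_withDensity_eq_integral_toReal_smul (by fun_prop)
      (ae_of_all _ fun _ => ENNReal.ofReal_lt_top)]
    refine integral_congr_ae ?_
    filter_upwards [hn2] with t ht
    simp only [ENNReal.toReal_ofReal ht, smul_eq_mul]
  have hf1 : IsFiniteMeasure ρ := isFiniteMeasure_withDensity_ofReal
    ((integrable_const 1).add (int_ev τ h)).2
  have hf2 : IsFiniteMeasure μ2 := isFiniteMeasure_withDensity_ofReal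
    (int_bdd (mm d) (mm_supp d) _ (continuous_const.add (continuous_const.mul A.continuous))).2
  have hac2 : μ2 ≪ mm d := withDensity_absolutelyContinuous _ _
  have heq : ρ.map (ev (ip θ)) = μ2 := by
    refine moment_ext _ _ ?_ (hac2.ae_le (mm_supp d)) ?_
    · exact (ae_map_iff hm.aemeasurable (p := fun t => t ∈ Set.Icc (-1:ℝ) 1) measurableSet_Icc).2
        (ae_of_all _ fun x => ip_mem θ x)
    · intro n
      rw [integral_map hm.aemeasurable (continuous_pow n).aestronglyMeasurable, i1, i2]
      obtain ⟨c, -, hc⟩ := Q_all τ hinv hd h k hk hh hΔ n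
      have a1 : ∀ x, (1 + ev h x) * ev (ip θ) x ^ n = ev (ip θ ^ n) x + ev (ip θ ^ n * h) x := by
        intro x; rw [ev_mul, ev_pow]; ring
      have a2 : ∀ t : ℝ, (1 + ev h θ * A.eval t) * t ^ n = t ^ n + ev h θ * (t ^ n * A.eval t) := by
        intro t; ring
      have hc1 : Continuous (fun t : ℝ => t ^ n * A.eval t) :=
        (continuous_pow n).mul A.continuous
      simp_rw [a1, a2]
      rw [integral_add (int_ev τ _) (int_ev τ _), integral_add
        (int_bdd (mm d) (mm_supp d) _ (continuous_pow n))
        ((int_bdd (mm d) (mm_supp d) _ hc1).const_mul _),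
        integral_const_mul, hc θ, ← int_push τ hinv hd θ (fun t : ℝ => t ^ n) (continuous_pow n).aestronglyMeasurable,
        ← int_push τ hinv hd e (fun t : ℝ => t ^ n * A.eval t) hc1.aestronglyMeasurable]
      have a3 : ∀ x, ev (ip e) x ^ n * A.eval (ev (ip e) x) = ev (ip e ^ n * h) x := by
        intro x; rw [ev_mul, ev_pow, hA]
      simp_rw [a3, hc e, he, ev_pow]
      ring
  have hσ1 : AEStronglyMeasurable (fun x => σ (ev (ip θ) x)) τ := by
    have : AEStronglyMeasurable σ (τ.map (ev (ip θ))) := by rwa [push τ hinv hd θ]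
    exact this.comp_measurable hm
  have k1 : ∫ x, σ (ev (ip θ) x) ∂ρ = ∫ t, σ t ∂μ2 := by
    rw [← heq, integral_map hm.aemeasurable]
    rw [heq]; exact hσm.mono_ac hac2
  rw [i1, i2] at k1
  have s1 : Integrable (fun x => σ (ev (ip θ) x)) τ :=
    Integrable.of_bound hσ1 C (ae_of_all _ fun x => hσ _ (ip_mem θ x))
  have s2 : Integrable σ (mm d) := Integrable.of_bound hσm C (by
    filter_upwards [mm_supp d] with t ht using hσ t ht)
  have s1' : Integrable (fun x => σ (ev (ip θ) x) * ev h x) τ :=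
    s1.mul_bdd (c := 1) hhm.aestronglyMeasurable (ae_of_all _ hb)
  have s2' : Integrable (fun t => σ t * A.eval t) (mm d) :=
    s2.mul_bdd (c := 1) hAm.aestronglyMeasurable hAb
  have b1 : ∀ x, (1 + ev h x) * σ (ev (ip θ) x) = σ (ev (ip θ) x) + σ (ev (ip θ) x) * ev h x := by
    intro x; ring
  have b2 : ∀ t, (1 + ev h θ * A.eval t) * σ t = σ t + ev h θ * (σ t * A.eval t) := by
    intro x; ring
  simp_rw [b1, b2] at k1
  rw [integral_add s1 s1', integral_add s2 (s2'.const_mul _), integral_const_mul,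
    int_push τ hinv hd θ σ hσm] at k1
  linarith

open Polynomial in
theorem sq_norm (τ : Measure (Metric.sphere (0 : EuclideanSpace ℝ (Fin d)) 1))
    [IsProbabilityMeasure τ] (hinv : Inv τ) (hd : 2 ≤ d)
    (e : Metric.sphere (0 : EuclideanSpace ℝ (Fin d)) 1)
    (h : MvPolynomial (Fin d) ℝ) (k : ℕ) (hk : 1 ≤ k) (hh : h.IsHomogeneous k)
    (hΔ : ∑ i : Fin d, MvPolynomial.pderiv i (MvPolynomial.pderiv i h) = 0)
    (he : ev h e = 1) (A : Polynomial ℝ)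
    (hA : ∀ x, ev h x = A.eval (ev (ip e) x)) :
    (∫ x, ev h x ^ 2 ∂τ) * ((((2 * k + d - 2) * Nat.factorial (k + d - 3) : ℕ) : ℝ)
          / ((Nat.factorial k * Nat.factorial (d - 2) : ℕ) : ℝ)) = 1 := by
  have hd' : (2 : ℝ) ≤ d := by exact_mod_cast hd
  have hintg : ∀ q : ℝ[X], Integrable (fun x => q.eval (ev (ip e) x)) τ := fun q =>
    int_cont τ _ (q.continuous.comp (cont_ev _))
  let Λ : ℝ[X] →ₗ[ℝ] ℝ :=
    { toFun := fun q => ∫ x, q.eval (ev (ip e) x) ∂τ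
      map_add' := fun p q => by
        simp only [eval_add]; exact integral_add (hintg p) (hintg q)
      map_smul' := fun c q => by
        simp only [eval_smul, smul_eq_mul, RingHom.id_apply]; exact integral_const_mul _ _ }
  have hΛ : ∀ q, Λ q = ∫ x, q.eval (ev (ip e) x) ∂τ := fun q => rfl
  have hΛQ : ∀ n, Λ (X ^ n * A) = ∫ x, ev (ip e ^ n * h) x ∂τ := by
    intro n
    rw [hΛ]
    refine integral_congr_ae (ae_of_all _ fun x => ?_)
    simp [ev_mul, ev_pow, hA]
  have hM : ∀ n : ℕ, (n : ℝ) * Λ (X ^ (n - 1)) = (n + d - 1) * Λ (X ^ (n + 1)) := by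
    intro n
    simp only [hΛ, eval_pow, eval_X]
    exact moment_rec τ hinv e n
  have hode := mm_poly_zero d hd ((1 - X ^ 2) * derivative (derivative A) - C ((d : ℝ) - 1) * X * derivative A
      + C ((k : ℝ) * (k + d - 2)) * A) (by
    set ψ := ((1 - X ^ 2) * derivative (derivative A) - C ((d : ℝ) - 1) * X * derivative A
      + C ((k : ℝ) * (k + d - 2)) * A) with hψ
    have := lam3 Λ d k A hM (fun n => by rw [hΛQ, hΛQ]; exact Q_rec τ hinv e h k hh hΔ n) ψ
    rw [← hψ, hΛ] at this
    have hc1 : Continuous (fun t : ℝ => ψ.eval t * ψ.eval t) := ψ.continuous.mul ψ.continuous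
    rw [← int_push τ hinv hd e (fun t : ℝ => ψ.eval t * ψ.eval t) hc1.aestronglyMeasurable]
    simpa using this)
  have hrec := ode_coeff A d k hode
  have hee : ev (ip e) e = 1 := by
    rw [ev_ip, real_inner_self_eq_norm_sq, mem_sphere_zero_iff_norm.1 e.2]; norm_num
  have hA1 : A.eval 1 = 1 := by
    have := hA e
    rw [hee, he] at this
    exact this.symm
  have h0 : (taylor 1 A).coeff 0 = 1 := by rw [taylor_coeff_zero, hA1]
  -- degree bound
  have hvan : ∀ j, k < j → (taylor 1 A).coeff j = 0 := by
    intro j hj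
    induction j, hj using Nat.le_induction with
    | base =>
      have := hrec k
      rw [sub_self, zero_mul, zero_mul] at this
      have hne : ((k : ℝ) + 1) * (2 * k + d - 1) ≠ 0 := by
        apply mul_ne_zero (by positivity)
        have : (0 : ℝ) ≤ k := Nat.cast_nonneg k
        linarith
      exact (mul_eq_zero.1 this).resolve_left hne
    | succ j hj ih =>
      have := hrec j
      rw [ih, mul_zero] at this
      have hne : ((j : ℝ) + 1) * (2 * j + d - 1) ≠ 0 := by
        apply mul_ne_zero (by positivity)
        have : (0 : ℝ) ≤ j := Nat.cast_nonneg j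
        linarith
      exact (mul_eq_zero.1 this).resolve_left hne
  have hdeg : (taylor 1 A).natDegree ≤ k := natDegree_le_iff_coeff_eq_zero.2 hvan
  have hdegA : A.natDegree ≤ k := by rwa [natDegree_taylor] at hdeg
  have hβk : ∀ j, j ≤ k → (taylor 1 A).coeff j ≠ 0 := by
    intro j
    induction j with
    | zero => intro _; rw [h0]; exact one_ne_zero
    | succ j ih =>
      intro hj hz
      have := hrec j
      rw [hz, mul_zero, eq_comm] at this
      have h1 : (k : ℝ) - j ≠ 0 := by
        rw [sub_ne_zero]; exact_mod_cast (by omega : k ≠ j)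
      have h2 : (k : ℝ) + j + d - 2 ≠ 0 := by
        have : (0 : ℝ) ≤ j := Nat.cast_nonneg j
        have : (1 : ℝ) ≤ k := by exact_mod_cast hk
        linarith
      exact (mul_ne_zero (mul_ne_zero h1 h2) (ih (by omega))) this
  have hdk : (taylor 1 A).natDegree = k := le_antisymm hdeg (le_natDegree_of_ne_zero (hβk k le_rfl))
  have hdAk : A.natDegree = k := by rwa [natDegree_taylor] at hdk
  have hlead : (taylor 1 A).coeff k = A.coeff k := by
    have := leadingCoeff_taylor (f := A) (r := (1 : ℝ))
    rwa [leadingCoeff, leadingCoeff, hdk, hdAk] at this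
  refine final_const d k hd hk (fun j => (taylor 1 A).coeff j) h0 hrec
    (∫ x, ev (ip e ^ k * h) x ∂τ) _ ?_ ?_
  · rw [Q_top τ hinv e k h hh hΔ, he, mul_one]
  · have s1 : ∫ x, ev h x ^ 2 ∂τ = Λ (A * A) := by
      rw [hΛ]
      refine integral_congr_ae (ae_of_all _ fun x => ?_)
      simp [hA, sq]
    have s2 : A * A = ∑ n ∈ Finset.range (k + 1), A.coeff n • (X ^ n * A) := by
      nth_rewrite 1 [A.as_sum_range_C_mul_X_pow]
      rw [hdAk, Finset.sum_mul]
      refine Finset.sum_congr rfl fun n _ => ?_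
      rw [smul_eq_C_mul]; ring
    rw [s1, s2, map_sum, Finset.sum_range_succ, Finset.sum_eq_zero, zero_add, map_smul, hΛQ, hlead, smul_eq_mul]
    intro n hn
    obtain ⟨c, hc0, hc⟩ := Q_all τ hinv hd h k hk hh hΔ n
    rw [map_smul, hΛQ, hc, hc0 (Finset.mem_range.1 hn)]; simp
end S11

namespace S11
open MeasureTheory
open scoped RealInnerProductSpace

theorem sigma_meas (d : ℕ) (A : Polynomial ℝ) (hA : A ≠ 0) (σ P : ℝ → ℝ)
    (hP : ∀ t ∈ Set.Icc (-1 : ℝ) 1, P t = A.eval t)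
    (hF : ∫ t in (-1 : ℝ)..1, P t * σ t * w d t ≠ 0) : AEStronglyMeasurable σ (mm d) := by
  have hi : IntervalIntegrable (fun t => P t * σ t * w d t) volume (-1) 1 := by
    by_contra h
    exact hF (intervalIntegral.integral_undef h)
  refine AEStronglyMeasurable.mono_ac (withDensity_absolutelyContinuous _ _)
    (μ := volume.restrict (Set.Ioc (-1 : ℝ) 1)) ?_
  have h1 : AEStronglyMeasurable (fun t => (P t * σ t * w d t) * (A.eval t * w d t)⁻¹)
      (volume.restrict (Set.Ioc (-1 : ℝ) 1)) := by
    refine hi.1.aestronglyMeasurable.mul (Measurable.aestronglyMeasurable ?_)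
    exact (A.continuous.measurable.mul (w_meas d)).inv
  refine h1.congr ?_
  have hr : ∀ᵐ t ∂(volume.restrict (Set.Ioc (-1 : ℝ) 1)), A.eval t ≠ 0 := by
    apply ae_restrict_of_ae
    have := (Polynomial.finite_setOfPred_isRoot hA).measure_zero volume
    exact measure_eq_zero_iff_ae_notMem.1 this
  have h2 : ∀ᵐ t ∂(volume.restrict (Set.Ioc (-1 : ℝ) 1)), t ≠ 1 :=
    ae_restrict_of_ae (Measure.ae_ne volume 1)
  filter_upwards [hr, h2, ae_restrict_mem measurableSet_Ioc] with t ht ht1 htm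
  rw [hP t ⟨htm.1.le, htm.2⟩]
  have := (w_pos d t ⟨htm.1, lt_of_le_of_ne htm.2 ht1⟩).ne'
  field_simp

theorem main (d k : ℕ) (hd : 2 ≤ d) (hk : 1 ≤ k)
    (σ : ℝ → ℝ) (hσ : ∃ C : ℝ, ∀ t ∈ Set.Icc (-1 : ℝ) 1, |σ t| ≤ C)
    (L : EuclideanSpace ℝ (Fin d) → ℝ) (P : ℝ → ℝ) (j0 : Fin d) (hj0 : (j0 : ℕ) = d - 1)
    (hpoly : ∃ p : MvPolynomial (Fin d) ℝ, p.IsHomogeneous k ∧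
      (∑ i : Fin d, MvPolynomial.pderiv i (MvPolynomial.pderiv i p) = 0) ∧
      ∀ x : EuclideanSpace ℝ (Fin d), L x = MvPolynomial.eval (fun i => x i) p)
    (hLP : ∀ x : EuclideanSpace ℝ (Fin d), ‖x‖ = 1 →
      L x = P ⟪x, EuclideanSpace.single j0 (1 : ℝ)⟫)
    (hLnorm : L (EuclideanSpace.single j0 (1 : ℝ)) = 1)
    (hLbound : ∀ x : EuclideanSpace ℝ (Fin d), ‖x‖ = 1 → |L x| ≤ 1)
    (τ : Measure (Metric.sphere (0 : EuclideanSpace ℝ (Fin d)) 1))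
    [IsProbabilityMeasure τ]
    (hinv : ∀ O : EuclideanSpace ℝ (Fin d) ≃ₗᵢ[ℝ] EuclideanSpace ℝ (Fin d),
      ∀ f : EuclideanSpace ℝ (Fin d) → ℝ, Continuous f →
        ∫ x, f (O (x : EuclideanSpace ℝ (Fin d))) ∂τ
          = ∫ x, f (x : EuclideanSpace ℝ (Fin d)) ∂τ)
    (γ : ℝ) (hγ : γ = 2 / ∫ x, |L (x : EuclideanSpace ℝ (Fin d))| ∂τ)
    (μ ν : Measure (Metric.sphere (0 : EuclideanSpace ℝ (Fin d)) 1))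
    (hμ : μ = τ.withDensity (fun x => ENNReal.ofReal
      (γ * max (L (x : EuclideanSpace ℝ (Fin d))) 0)))
    (hν : ν = τ.withDensity (fun x => ENNReal.ofReal
      (γ * max (-(L (x : EuclideanSpace ℝ (Fin d)))) 0)))
    (hcoef : ∫ t in (-1 : ℝ)..1, P t * σ t * (1 - t ^ 2) ^ (((d : ℝ) - 3) / 2) ≠ 0) :
    (⨆ θ : Metric.sphere (0 : EuclideanSpace ℝ (Fin d)) 1,
        |∫ x, σ ⟪(x : EuclideanSpace ℝ (Fin d)), (θ : EuclideanSpace ℝ (Fin d))⟫ ∂μ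
          - ∫ x, σ ⟪(x : EuclideanSpace ℝ (Fin d)), (θ : EuclideanSpace ℝ (Fin d))⟫ ∂ν|)
      / Real.sqrt (∫ θ,
          (∫ x, σ ⟪(x : EuclideanSpace ℝ (Fin d)), (θ : EuclideanSpace ℝ (Fin d))⟫ ∂μ
            - ∫ x, σ ⟪(x : EuclideanSpace ℝ (Fin d)), (θ : EuclideanSpace ℝ (Fin d))⟫ ∂ν) ^ 2
          ∂τ)
      = Real.sqrt ((((2 * k + d - 2) * Nat.factorial (k + d - 3) : ℕ) : ℝ)
          / ((Nat.factorial k * Nat.factorial (d - 2) : ℕ) : ℝ)) := by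
  
  obtain ⟨p, hh, hΔ, hLp⟩ := hpoly
  obtain ⟨C, hC⟩ := hσ
  let i0 : Fin d := ⟨0, by omega⟩
  have hij : i0 ≠ j0 := by
    intro h
    have := congrArg Fin.val h
    simp only [i0, hj0] at this
    omega
  let e : Metric.sphere (0 : EuclideanSpace ℝ (Fin d)) 1 :=
    ⟨EuclideanSpace.single j0 1, by simp⟩
  have hLe : ∀ x : Metric.sphere (0 : EuclideanSpace ℝ (Fin d)) 1, L x = ev p x := fun x => hLp x
  have hn : ∀ x : Metric.sphere (0 : EuclideanSpace ℝ (Fin d)) 1,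
      ‖(x : EuclideanSpace ℝ (Fin d))‖ = 1 := fun x => mem_sphere_zero_iff_norm.1 x.2
  have he : ev p e = 1 := by rw [← hLe]; exact hLnorm
  have hb : ∀ x, |ev p x| ≤ 1 := fun x => by rw [← hLe]; exact hLbound x (hn x)
  obtain ⟨A, B, hAB⟩ := polyA i0 j0 p
  have hP0 : ∀ s t : ℝ, s ^ 2 + t ^ 2 = 1 → P t = A.eval t + s * B.eval t := by
    intro s t hst
    have key : ‖(WithLp.toLp 2 (fun l => if l = j0 then t else if l = i0 then s else 0) :
        EuclideanSpace ℝ (Fin d))‖ = 1 := by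
      rw [EuclideanSpace.norm_eq, Real.sqrt_eq_one]
      have : ∀ l : Fin d, ‖(if l = j0 then t else if l = i0 then s else 0 : ℝ)‖ ^ 2
          = (if l = j0 then t ^ 2 else 0) + (if l = i0 then s ^ 2 else 0) := by
        intro l
        by_cases h1 : l = j0
        · have h2 : l ≠ i0 := fun h => hij (h ▸ h1)
          simp [h1, hij.symm]
        · by_cases h2 : l = i0
          · simp [h2, hij]
          · simp [h1, h2]
      simp only [this, Finset.sum_add_distrib]
      simp
      linarith
    have h1 := hLP _ key
    rw [hLp] at h1
    rw [← hAB s t hst]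
    rw [EuclideanSpace.inner_single_right] at h1
    simpa using h1.symm
  have hPA : ∀ t ∈ Set.Icc (-1 : ℝ) 1, P t = A.eval t := by
    intro t ht
    have hs : 0 ≤ 1 - t ^ 2 := by nlinarith [ht.1, ht.2]
    have h1 := hP0 (Real.sqrt (1 - t ^ 2)) t (by rw [Real.sq_sqrt hs]; ring)
    have h2 := hP0 (-Real.sqrt (1 - t ^ 2)) t (by rw [neg_sq, Real.sq_sqrt hs]; ring)
    linarith
  have hA : ∀ x, ev p x = A.eval (ev (ip e) x) := by
    intro x
    rw [← hPA _ (ip_mem e x), ev_ip, ← hLe]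
    exact hLP x (hn x)
  have hA0 : A ≠ 0 := by
    rintro rfl
    have := hA e
    simp [he] at this
  have hσm : AEStronglyMeasurable σ (mm d) := sigma_meas d A hA0 σ P hPA hcoef
  have hInv : Inv τ := hinv
  set lam := ∫ t, σ t * A.eval t ∂(mm d) with hlam
  have hlam0 : lam ≠ 0 := by
    rw [hlam, mm_integral d hd]
    refine div_ne_zero ?_ (W_pos d hd).ne'
    convert hcoef using 1
    refine intervalIntegral.integral_congr fun t ht => ?_
    rw [Set.uIcc_of_le (by norm_num)] at ht
    simp only [hPA t ht, w]
    ring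
  have hFH := fun θ => FH τ hInv hd θ e p k hk hh hΔ hb he A hA σ C hC hσm
  have hsq := sq_norm τ hInv hd e p k hk hh hΔ he A hA
  set N := ((((2 * k + d - 2) * Nat.factorial (k + d - 3) : ℕ) : ℝ)
          / ((Nat.factorial k * Nat.factorial (d - 2) : ℕ) : ℝ)) with hN
  have hN0 : 0 ≤ N := by positivity
  have hI2 : Integrable (fun x => ev p x ^ 2) τ := int_cont τ _ ((cont_ev p).pow 2)
  have hI2pos : 0 < ∫ x, ev p x ^ 2 ∂τ := by
    have h0 : 0 ≤ ∫ x, ev p x ^ 2 ∂τ := integral_nonneg fun x => sq_nonneg _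
    refine lt_of_le_of_ne h0 fun h => ?_
    rw [← h, zero_mul] at hsq
    exact zero_ne_one hsq
  have habs : 0 < ∫ x, |L (x : EuclideanSpace ℝ (Fin d))| ∂τ := by
    refine lt_of_lt_of_le hI2pos ?_
    simp only [hLe]
    refine integral_mono hI2 (int_ev τ p).abs fun x => ?_
    show ev p x ^ 2 ≤ |ev p x|
    rw [← sq_abs]
    nlinarith [hb x, abs_nonneg (ev p x)]
  have hγ0 : 0 < γ := by rw [hγ]; positivity
  have hσ1 : ∀ θ : Metric.sphere (0 : EuclideanSpace ℝ (Fin d)) 1,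
      Integrable (fun x => σ (ev (ip θ) x)) τ := by
    intro θ
    refine Integrable.of_bound ?_ C (ae_of_all _ fun x => hC _ (ip_mem θ x))
    have : AEStronglyMeasurable σ (τ.map (ev (ip θ))) := by rwa [push τ hInv hd θ]
    exact this.comp_measurable (cont_ev _).measurable
  have hwd : ∀ (q : Metric.sphere (0 : EuclideanSpace ℝ (Fin d)) 1 → ℝ), Continuous q →
      ∀ f : Metric.sphere (0 : EuclideanSpace ℝ (Fin d)) 1 → ℝ,
      ∫ x, f x ∂(τ.withDensity fun x => ENNReal.ofReal (γ * max (q x) 0))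
        = ∫ x, f x * (γ * max (q x) 0) ∂τ := by
    intro q hq f
    rw [integral_withDensity_eq_integral_toReal_smul
      (by have := hq.measurable; fun_prop) (ae_of_all _ fun _ => ENNReal.ofReal_lt_top)]
    refine integral_congr_ae (ae_of_all _ fun x => ?_)
    simp only [ENNReal.toReal_ofReal (mul_nonneg hγ0.le (le_max_right (q x) 0)), smul_eq_mul]
    ring
  have hwi : ∀ (q : Metric.sphere (0 : EuclideanSpace ℝ (Fin d)) 1 → ℝ), Continuous q →
      (∀ x, |q x| ≤ 1) → ∀ θ : Metric.sphere (0 : EuclideanSpace ℝ (Fin d)) 1,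
      Integrable (fun x => σ (ev (ip θ) x) * (γ * max (q x) 0)) τ := by
    intro q hq hq1 θ
    refine (hσ1 θ).mul_bdd (c := γ)
      (Continuous.aestronglyMeasurable (by fun_prop)) (ae_of_all _ fun x => ?_)
    rw [Real.norm_eq_abs, abs_of_nonneg (mul_nonneg hγ0.le (le_max_right (q x) 0))]
    have : max (q x) 0 ≤ 1 := max_le (abs_le.1 (hq1 x)).2 zero_le_one
    nlinarith
  have hg : ∀ θ : Metric.sphere (0 : EuclideanSpace ℝ (Fin d)) 1,
      (∫ x, σ ⟪(x : EuclideanSpace ℝ (Fin d)), (θ : EuclideanSpace ℝ (Fin d))⟫ ∂μ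
          - ∫ x, σ ⟪(x : EuclideanSpace ℝ (Fin d)), (θ : EuclideanSpace ℝ (Fin d))⟫ ∂ν)
        = γ * lam * ev p θ := by
    intro θ
    simp only [hμ, hν, ← ev_ip, hLe]
    rw [hwd (ev p) (cont_ev p), hwd (fun x => -ev p x) (cont_ev p).neg,
      ← integral_sub (hwi (ev p) (cont_ev p) hb θ)
        (hwi (fun x => -ev p x) (cont_ev p).neg (fun x => by rw [abs_neg]; exact hb x) θ)]
    have : ∀ x, σ (ev (ip θ) x) * (γ * max (ev p x) 0) - σ (ev (ip θ) x) * (γ * max (-ev p x) 0)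
        = γ * (σ (ev (ip θ) x) * ev p x) := by
      intro x
      rcases le_total (ev p x) 0 with h | h
      · rw [max_eq_right h, max_eq_left (by linarith)]; ring
      · rw [max_eq_left h, max_eq_right (by linarith)]; ring
    simp_rw [this]
    rw [integral_const_mul, hFH θ]
    ring
  simp only [hg]
  set c := γ * lam with hc
  have hc0 : c ≠ 0 := mul_ne_zero hγ0.ne' hlam0
  have hsup : (⨆ θ : Metric.sphere (0 : EuclideanSpace ℝ (Fin d)) 1, |c * ev p θ|) = |c| := by
    have hle : ∀ θ : Metric.sphere (0 : EuclideanSpace ℝ (Fin d)) 1, |c * ev p θ| ≤ |c| := by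
      intro θ
      rw [abs_mul]
      exact mul_le_of_le_one_right (abs_nonneg _) (hb θ)
    have : Nonempty (Metric.sphere (0 : EuclideanSpace ℝ (Fin d)) 1) := ⟨e⟩
    refine le_antisymm (ciSup_le hle) ?_
    have := le_ciSup (f := fun θ : Metric.sphere (0 : EuclideanSpace ℝ (Fin d)) 1 => |c * ev p θ|)
      ⟨|c|, by rintro _ ⟨θ, rfl⟩; exact hle θ⟩ e
    simpa [he] using this
  rw [hsup]
  simp_rw [mul_pow]
  rw [integral_const_mul, Real.sqrt_mul (sq_nonneg c), Real.sqrt_sq_eq_abs]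
  have hS : Real.sqrt (∫ x, ev p x ^ 2 ∂τ) * Real.sqrt N = 1 := by
    rw [← Real.sqrt_mul hI2pos.le, hsq, Real.sqrt_one]
  have h1 : |c| ≠ 0 := abs_ne_zero.2 hc0
  have h2 : Real.sqrt (∫ x, ev p x ^ 2 ∂τ) ≠ 0 := (Real.sqrt_pos.2 hI2pos).ne'
  rw [div_eq_iff (mul_ne_zero h1 h2)]
  linear_combination (-|c|) * hS

end S11

open MeasureTheory intervalIntegral
open scoped RealInnerProductSpace

/-- with `μ_d, ν_d` the positive/negative parts of the degree-`k` Legendre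
harmonic density on `S^{d-1}` and `σ` a bounded activation, provided the Funk–Hecke coefficient
`∫_{−1}^1 P_{k,d}(t)σ(t)(1−t²)^{(d−3)/2} dt` is nonzero, the ratio of the `F₁` IPM to the `F₂`
(kernel MMD) IPM equals `√N_{k,d} = √((2k+d−2)(k+d−3)!/(k!(d−2)!))`. -/
theorem stmt_11 (d k : ℕ) (hd : 2 ≤ d) (hk : 1 ≤ k)
    (σ : ℝ → ℝ) (hσ : ∃ C : ℝ, ∀ t ∈ Set.Icc (-1 : ℝ) 1, |σ t| ≤ C)
    (L : EuclideanSpace ℝ (Fin d) → ℝ) (P : ℝ → ℝ)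
    (hpoly : ∃ p : MvPolynomial (Fin d) ℝ, p.IsHomogeneous k ∧
      (∑ i : Fin d, MvPolynomial.pderiv i (MvPolynomial.pderiv i p) = 0) ∧
      ∀ x : EuclideanSpace ℝ (Fin d), L x = MvPolynomial.eval (fun i => x i) p)
    (hLP : ∀ x : EuclideanSpace ℝ (Fin d), ‖x‖ = 1 →
      L x = P ⟪x, EuclideanSpace.single (⟨d - 1, by omega⟩ : Fin d) (1 : ℝ)⟫)
    (hLnorm : L (EuclideanSpace.single (⟨d - 1, by omega⟩ : Fin d) (1 : ℝ)) = 1)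
    (hLbound : ∀ x : EuclideanSpace ℝ (Fin d), ‖x‖ = 1 → |L x| ≤ 1)
    (τ : Measure (Metric.sphere (0 : EuclideanSpace ℝ (Fin d)) 1))
    [IsProbabilityMeasure τ]
    (hinv : ∀ O : EuclideanSpace ℝ (Fin d) ≃ₗᵢ[ℝ] EuclideanSpace ℝ (Fin d),
      ∀ f : EuclideanSpace ℝ (Fin d) → ℝ, Continuous f →
        ∫ x, f (O (x : EuclideanSpace ℝ (Fin d))) ∂τ
          = ∫ x, f (x : EuclideanSpace ℝ (Fin d)) ∂τ)
    (γ : ℝ) (hγ : γ = 2 / ∫ x, |L (x : EuclideanSpace ℝ (Fin d))| ∂τ)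
    (μ ν : Measure (Metric.sphere (0 : EuclideanSpace ℝ (Fin d)) 1))
    (hμ : μ = τ.withDensity (fun x => ENNReal.ofReal
      (γ * max (L (x : EuclideanSpace ℝ (Fin d))) 0)))
    (hν : ν = τ.withDensity (fun x => ENNReal.ofReal
      (γ * max (-(L (x : EuclideanSpace ℝ (Fin d)))) 0)))
    (hcoef : ∫ t in (-1 : ℝ)..1, P t * σ t * (1 - t ^ 2) ^ (((d : ℝ) - 3) / 2) ≠ 0) :
    (⨆ θ : Metric.sphere (0 : EuclideanSpace ℝ (Fin d)) 1,
        |∫ x, σ ⟪(x : EuclideanSpace ℝ (Fin d)), (θ : EuclideanSpace ℝ (Fin d))⟫ ∂μ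
          - ∫ x, σ ⟪(x : EuclideanSpace ℝ (Fin d)), (θ : EuclideanSpace ℝ (Fin d))⟫ ∂ν|)
      / Real.sqrt (∫ θ,
          (∫ x, σ ⟪(x : EuclideanSpace ℝ (Fin d)), (θ : EuclideanSpace ℝ (Fin d))⟫ ∂μ
            - ∫ x, σ ⟪(x : EuclideanSpace ℝ (Fin d)), (θ : EuclideanSpace ℝ (Fin d))⟫ ∂ν) ^ 2
          ∂τ)
      = Real.sqrt ((((2 * k + d - 2) * Nat.factorial (k + d - 3) : ℕ) : ℝ)
          / ((Nat.factorial k * Nat.factorial (d - 2) : ℕ) : ℝ)) := by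
  exact S11.main d k hd hk σ hσ L P _ rfl hpoly hLP hLnorm hLbound τ hinv γ hγ μ ν hμ hν hcoef
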